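/- arXiv:math/0610197 — 6 statements merged into one kernel-verified Lean document; each statement's English description precedes it below -/
import Mathlib

section
/- For every integer ℓ ≥ 1 and every real p ≥ 1, the Laplace-type integral ∫_0^∞ e^{-pt} I_ℓ(t) / t dt converges and equals (p + √(p² − 1))^{−ℓ} / ℓ. -/
open MeasureTheory Real

/-- Modified Bessel function of the first kind, integer order, defined by its series. -/
noncomputable def besselI (n : ℕ) (x : ℝ) : ℝ :=
  ∑' m : ℕ, (x / 2) ^ (n + 2 * m) / ((m.factorial : ℝ) * ((n + m).factorial : ℝ))

/-- Ballot numbers: `ballot l m` counts the nearest-neighbour walks of length `l + 2 * m` from `l`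
that hit `0` for the first time at their last step. -/
def ballot : ℕ → ℕ → ℕ
  | 0, 0 => 1
  | 0, _ + 1 => 0
  | l + 1, 0 => ballot l 0
  | l + 1, m + 1 => ballot l (m + 1) + ballot (l + 2) m
termination_by l m => (m, l)

theorem ballot_zero_right (l : ℕ) : ballot l 0 = 1 := by
  induction l with
  | zero => simp [ballot]
  | succ l ih => simpa [ballot] using ih

theorem ballot_succ_mul_factorial (l m : ℕ) :
    ballot (l + 1) m * (m.factorial * (l + 1 + m).factorial) =
      (l + 1) * (l + 2 * m).factorial := by
  induction m generalizing l with
  | zero => simp [ballot_zero_right, Nat.factorial_succ]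
  | succ m ihm =>
    induction l with
    | zero =>
      have h := ihm 1
      rw [show 1 + 1 + m = m + 2 by ring, show 1 + 2 * m = 2 * m + 1 by ring] at h
      rw [ballot, ballot, show 0 + 1 + (m + 1) = m + 2 by ring,
        show 0 + 2 * (m + 1) = 2 * m + 1 + 1 by ring, Nat.factorial_succ m,
        Nat.factorial_succ (2 * m + 1)]
      simp only [zero_add] at h ⊢
      linear_combination (m + 1) * h
    | succ l ihl =>
      have h := ihm (l + 2)
      rw [show l + 2 + 1 + m = l + m + 2 + 1 by ring,
        show l + 2 + 2 * m = l + 2 * m + 2 by ring, Nat.factorial_succ (l + m + 2)] at h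
      rw [show l + 1 + (m + 1) = l + m + 2 by ring,
        show l + 2 * (m + 1) = l + 2 * m + 2 by ring, Nat.factorial_succ m] at ihl
      rw [ballot, show l + 1 + 1 + (m + 1) = l + m + 2 + 1 by ring,
        show l + 1 + 2 * (m + 1) = l + 2 * m + 2 + 1 by ring, Nat.factorial_succ (l + m + 2),
        Nat.factorial_succ (l + 2 * m + 2), Nat.factorial_succ m]
      linear_combination (l + m + 3) * ihl + (m + 1) * h

theorem sum_range_ballot_succ (x : ℝ) (l M : ℕ) :
    ∑ m ∈ Finset.range (M + 1), (ballot (l + 1) m : ℝ) * x ^ (l + 1 + 2 * m) =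
      x * (∑ m ∈ Finset.range (M + 1), (ballot l m : ℝ) * x ^ (l + 2 * m) +
        ∑ m ∈ Finset.range M, (ballot (l + 2) m : ℝ) * x ^ (l + 2 + 2 * m)) := by
  rw [Finset.sum_range_succ', Finset.sum_range_succ' (fun m => (ballot l m : ℝ) * _),
    add_right_comm (Finset.sum _ _), ← Finset.sum_add_distrib, mul_add, Finset.mul_sum]
  congr 1
  · refine Finset.sum_congr rfl fun m _ => ?_
    rw [ballot]
    push_cast
    ring
  · simp only [ballot_zero_right]
    push_cast
    ring

theorem sum_range_ballot_le {x q : ℝ} (hx : 0 ≤ x) (hq : 0 ≤ q) (hxq : x * (1 + q ^ 2) = q)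
    (l M : ℕ) : ∑ m ∈ Finset.range M, (ballot l m : ℝ) * x ^ (l + 2 * m) ≤ q ^ l := by
  induction M generalizing l with
  | zero => simpa using pow_nonneg hq l
  | succ M ihM =>
    induction l with
    | zero => simp [Finset.sum_range_succ', ballot]
    | succ l ihl =>
      rw [sum_range_ballot_succ]
      calc _ ≤ x * (q ^ l + q ^ (l + 2)) := by gcongr; exact ihM _
        _ = q ^ (l + 1) := by linear_combination q ^ l * hxq

theorem summable_ballot {x q : ℝ} (hx : 0 ≤ x) (hq : 0 ≤ q) (hxq : x * (1 + q ^ 2) = q)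
    (l : ℕ) : Summable fun m => (ballot l m : ℝ) * x ^ (l + 2 * m) :=
  summable_of_sum_range_le (fun _ => by positivity) (sum_range_ballot_le hx hq hxq l)

/-- A bounded convex sequence starting at `0` with nonnegative terms vanishes, provided it
satisfies a second order linear recurrence. -/
theorem eq_zero_of_bounded_of_recurrence {d : ℕ → ℝ} {p C : ℝ} (hp : 1 ≤ p) (h0 : d 0 = 0)
    (hd : ∀ n, 0 ≤ d n) (hC : ∀ n, d n ≤ C) (hrec : ∀ n, d (n + 2) = 2 * p * d (n + 1) - d n)
    (n : ℕ) : d n = 0 := by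
  have hmono : ∀ n, d 1 ≤ d (n + 1) - d n := by
    intro n
    induction n with
    | zero => simp [h0]
    | succ n ih => nlinarith [hrec n, hd (n + 1)]
  have hlin : ∀ n : ℕ, n * d 1 ≤ d n := by
    intro n
    induction n with
    | zero => simp [h0]
    | succ n ih => push_cast; linarith [hmono n]
  have h1 : d 1 = 0 := by
    refine le_antisymm (not_lt.1 fun h => ?_) (hd 1)
    obtain ⟨n, hn⟩ := exists_nat_gt (C / d 1)
    rw [div_lt_iff₀ h] at hn
    linarith [hlin n, hC n]
  induction n using Nat.twoStepInduction with
  | zero => exact h0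
  | one => exact h1
  | more n ih ih' => simp [hrec, ih, ih']

theorem hasSum_ballot {p q : ℝ} (hp : 1 ≤ p) (hq : 0 ≤ q) (hq1 : q ≤ 1)
    (hpq : 1 + q ^ 2 = 2 * p * q) (l : ℕ) :
    HasSum (fun m => (ballot l m : ℝ) * (1 / (2 * p)) ^ (l + 2 * m)) (q ^ l) := by
  have hp0 : p ≠ 0 := by positivity
  set x := 1 / (2 * p) with hx
  have hx0 : 0 ≤ x := by positivity
  have hpx : 2 * p * x = 1 := by rw [hx]; field_simp
  have hxq : x * (1 + q ^ 2) = q := by linear_combination x * hpq + q * hpx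
  have hs := summable_ballot hx0 hq hxq
  set f : ℕ → ℝ := fun l => ∑' m, (ballot l m : ℝ) * x ^ (l + 2 * m) with hf
  have hf0 : f 0 = 1 := by
    rw [hf]
    refine (tsum_eq_single 0 fun m hm => ?_).trans (by simp [ballot])
    obtain ⟨m, rfl⟩ := Nat.exists_eq_succ_of_ne_zero hm
    simp [ballot]
  have hfrec : ∀ n, f (n + 1) = x * (f n + f (n + 2)) := by
    intro n
    have hlim : ∀ k, Filter.Tendsto (fun M => ∑ m ∈ Finset.range M,
        (ballot k m : ℝ) * x ^ (k + 2 * m)) Filter.atTop (nhds (f k)) :=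
      fun k => (hs k).hasSum.tendsto_sum_nat
    refine tendsto_nhds_unique ((hlim (n + 1)).comp (Filter.tendsto_add_atTop_nat 1)) ?_
    refine ((((hlim n).comp (Filter.tendsto_add_atTop_nat 1)).add
      (hlim (n + 2))).const_mul x).congr fun M => ?_
    exact (sum_range_ballot_succ x n M).symm
  have hle : ∀ n, f n ≤ q ^ n := fun n =>
    (hs n).tsum_le_of_sum_range_le (sum_range_ballot_le hx0 hq hxq n)
  have hnonneg : ∀ n, 0 ≤ f n := fun n => tsum_nonneg fun m => by positivity
  have hzero := eq_zero_of_bounded_of_recurrence (d := fun n => q ^ n - f n) (C := 1) hp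
    (by simp [hf0]) (fun n => sub_nonneg.2 (hle n))
    (fun n => by linarith [hnonneg n, pow_le_one₀ hq hq1 (n := n)])
    (fun n => by linear_combination q ^ n * hpq + 2 * p * hfrec n + (f n + f (n + 2)) * hpx) l
  have hfl : f l = q ^ l := (sub_eq_zero.1 hzero).symm
  exact hfl ▸ (hs l).hasSum

theorem integral_exp_mul_besselI_term {p : ℝ} (hp : 0 < p) (l m : ℕ) :
    ∫ t in Set.Ioi (0 : ℝ), Real.exp (-p * t) * ((t / 2) ^ (l + 1 + 2 * m) /
        ((m.factorial : ℝ) * ((l + 1 + m).factorial : ℝ))) / t =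
      (ballot (l + 1) m : ℝ) * (1 / (2 * p)) ^ (l + 1 + 2 * m) / (l + 1) := by
  have hG := Real.integral_rpow_mul_exp_neg_mul_Ioi (a := (l + 2 * m : ℕ) + 1) (by positivity) hp
  rw [Real.Gamma_nat_eq_factorial] at hG
  have hb : (ballot (l + 1) m : ℝ) * ((m.factorial : ℝ) * ((l + 1 + m).factorial : ℝ)) =
      (l + 1) * ((l + 2 * m).factorial : ℝ) := mod_cast ballot_succ_mul_factorial l m
  have hfac : ((m.factorial : ℝ) * ((l + 1 + m).factorial : ℝ)) ≠ 0 := by positivity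
  have hcongr : ∀ t ∈ Set.Ioi (0 : ℝ), Real.exp (-p * t) * ((t / 2) ^ (l + 1 + 2 * m) /
        ((m.factorial : ℝ) * ((l + 1 + m).factorial : ℝ))) / t =
      ((1 / 2) ^ (l + 1 + 2 * m) / ((m.factorial : ℝ) * ((l + 1 + m).factorial : ℝ))) *
        (t ^ (((l + 2 * m : ℕ) + 1 : ℝ) - 1) * Real.exp (-(p * t))) := by
    intro t ht
    have ht0 : t ≠ 0 := (Set.mem_Ioi.1 ht).ne'
    rw [add_sub_cancel_right, Real.rpow_natCast, neg_mul,
      show l + 1 + 2 * m = l + 2 * m + 1 by ring, div_pow, one_div_pow, pow_succ t]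
    field_simp
  rw [setIntegral_congr_fun measurableSet_Ioi hcongr, integral_const_mul, hG,
    show ((l + 2 * m : ℕ) + 1 : ℝ) = ((l + 1 + 2 * m : ℕ) : ℝ) by push_cast; ring,
    Real.rpow_natCast, eq_div_of_mul_eq hfac hb, one_div_pow, one_div_pow, one_div_pow, mul_pow]
  field_simp

theorem ballot_succ_pos (l m : ℕ) : 0 < ballot (l + 1) m := by
  refine Nat.pos_of_mul_pos_right (b := m.factorial * (l + 1 + m).factorial) ?_
  rw [ballot_succ_mul_factorial]
  positivity

theorem laplace_integral_besselI (ℓ : ℕ) (hℓ : 1 ≤ ℓ) (p : ℝ) (hp : 1 ≤ p) :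
    IntegrableOn (fun t : ℝ => Real.exp (-p * t) * besselI ℓ t / t) (Set.Ioi 0) ∧
    ∫ t in Set.Ioi (0 : ℝ), Real.exp (-p * t) * besselI ℓ t / t
      = (p + Real.sqrt (p ^ 2 - 1)) ^ (-(ℓ : ℤ)) / ℓ := by
  obtain ⟨l, rfl⟩ := Nat.exists_eq_add_of_le' hℓ
  have hp0 : 0 < p := by positivity
  set r := p + Real.sqrt (p ^ 2 - 1) with hr
  have hsq : Real.sqrt (p ^ 2 - 1) ^ 2 = p ^ 2 - 1 := Real.sq_sqrt (by nlinarith)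
  have hr1 : 1 ≤ r := by linarith [Real.sqrt_nonneg (p ^ 2 - 1)]
  have hr0 : 0 < r := by positivity
  have hrp : r ^ 2 + 1 = 2 * p * r := by rw [hr]; linear_combination hsq
  have hsum := (hasSum_ballot hp (inv_nonneg.2 hr0.le) (inv_le_one_of_one_le₀ hr1)
    (by field_simp; linear_combination hrp) (l + 1)).div_const ((l : ℝ) + 1)
  set F : ℕ → ℝ → ℝ := fun m t => Real.exp (-p * t) * ((t / 2) ^ (l + 1 + 2 * m) /
    ((m.factorial : ℝ) * ((l + 1 + m).factorial : ℝ))) / t with hF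
  have hFint : ∀ m, ∫ t in Set.Ioi (0 : ℝ), F m t = _ :=
    integral_exp_mul_besselI_term hp0 l
  have hFi : ∀ m, Integrable (F m) (volume.restrict (Set.Ioi 0)) := by
    intro m
    refine Integrable.of_integral_ne_zero ?_
    have := ballot_succ_pos l m
    rw [hFint]
    positivity
  have hnorm : ∀ m, ∫ t in Set.Ioi (0 : ℝ), ‖F m t‖ = ∫ t in Set.Ioi (0 : ℝ), F m t := by
    refine fun m => setIntegral_congr_fun measurableSet_Ioi fun t ht => ?_
    have ht0 : 0 < t := ht
    exact Real.norm_of_nonneg (by simp only [hF]; positivity)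
  have hbes : (fun t : ℝ => Real.exp (-p * t) * besselI (l + 1) t / t) =
      fun t => ∑' m, F m t := by
    funext t
    rw [besselI, ← tsum_mul_left, ← tsum_div_const]
  have hmain := hasSum_integral_of_summable_integral_norm hFi
    (by simpa only [hnorm, hFint] using hsum.summable)
  simp only [hFint] at hmain
  have hval : ∫ t in Set.Ioi (0 : ℝ), Real.exp (-p * t) * besselI (l + 1) t / t =
      r ^ (-((l + 1 : ℕ) : ℤ)) / (l + 1 : ℕ) := by
    rw [hbes, hmain.unique hsum, zpow_neg, zpow_natCast, inv_pow]
    push_cast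
    rfl
  refine ⟨Integrable.of_integral_ne_zero ?_, hval⟩
  rw [hval]
  positivity
end

section
/- For every integer ℓ ≥ 1, the integral ∫_0^∞ e^{-t} I_ℓ(t) / t dt converges and equals 1/ℓ; equivalently, the first-passage density F̄(ℓ,t) = e^{-t} (ℓ/t) I_ℓ(t) integrates to 1 over (0,∞). -/
open MeasureTheory Real

open Filter Topology

/-- The probability that a simple symmetric random walk returns to its start at time `2 * m`. -/
noncomputable def returnProb (m : ℕ) : ℝ :=
  ((2 * m).factorial : ℝ) / (2 ^ (2 * m) * (m.factorial : ℝ) * (m.factorial : ℝ))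

/-- The probability that a simple symmetric random walk first hits level `k + 1`
at time `k + 1 + 2 * m`. -/
noncomputable def hittingProb (k m : ℕ) : ℝ :=
  ((k : ℝ) + 1) * ((k + 2 * m).factorial : ℝ) /
    (2 ^ (k + 1 + 2 * m) * (m.factorial : ℝ) * ((k + 1 + m).factorial : ℝ))

lemma hittingProb_nonneg (k m : ℕ) : 0 ≤ hittingProb k m := by
  unfold hittingProb
  positivity

lemma returnProb_succ (m : ℕ) :
    returnProb (m + 1) = returnProb m * ((2 * m + 1) / (2 * m + 2)) := by
  have hm := Nat.factorial_ne_zero m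
  unfold returnProb
  rw [show 2 * (m + 1) = 2 * m + 1 + 1 by ring]
  simp only [Nat.factorial_succ, pow_succ]
  push_cast
  field_simp
  ring

lemma hittingProb_zero_left (m : ℕ) :
    hittingProb 0 m = returnProb m - returnProb (m + 1) := by
  rw [returnProb_succ]
  unfold hittingProb returnProb
  rw [show 0 + 1 + m = m + 1 by ring, show 0 + 1 + 2 * m = 2 * m + 1 by ring, zero_add]
  simp only [Nat.factorial_succ, pow_succ]
  push_cast
  field_simp
  ring

lemma returnProb_sq_mul_le (m : ℕ) : returnProb m ^ 2 * (2 * m + 1) ≤ 1 := by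
  induction m with
  | zero => simp [returnProb]
  | succ m ih =>
    refine le_trans ?_ ih
    rw [returnProb_succ, mul_pow, mul_assoc]
    gcongr
    rw [div_pow, div_mul_eq_mul_div, div_le_iff₀ (by positivity)]
    push_cast
    have hm : (0 : ℝ) ≤ m := m.cast_nonneg
    nlinarith

lemma tendsto_returnProb : Tendsto returnProb atTop (𝓝 0) := by
  have h : Tendsto (fun m => returnProb m ^ 2) atTop (𝓝 0) := by
    refine squeeze_zero (fun m => sq_nonneg _) (fun m => ?_)
      (tendsto_one_div_add_atTop_nhds_zero_nat (𝕜 := ℝ))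
    rw [le_div_iff₀ (by positivity)]
    refine le_trans ?_ (returnProb_sq_mul_le m)
    gcongr
    linarith [(m.cast_nonneg : (0 : ℝ) ≤ m)]
  rw [tendsto_zero_iff_abs_tendsto_zero]
  simpa [Real.sqrt_sq_eq_abs, Function.comp_def] using h.sqrt

lemma hittingProb_zero_right (k : ℕ) : hittingProb k 0 = (1 / 2) ^ (k + 1) := by
  unfold hittingProb
  simp only [mul_zero, add_zero, Nat.factorial_succ, Nat.factorial_zero]
  push_cast
  rw [one_div_pow]
  field_simp

lemma hittingProb_one_left (m : ℕ) : hittingProb 1 m = 2 * hittingProb 0 (m + 1) := by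
  unfold hittingProb
  rw [show 1 + 2 * m = 2 * m + 1 by ring, show 1 + 1 + 2 * m = 2 * m + 2 by ring,
    show 1 + 1 + m = m + 2 by ring, show 0 + 2 * (m + 1) = 2 * m + 2 by ring,
    show 0 + 1 + 2 * (m + 1) = 2 * m + 3 by ring, show 0 + 1 + (m + 1) = m + 2 by ring]
  simp only [Nat.factorial_succ, pow_succ]
  push_cast
  field_simp
  ring

lemma hittingProb_add_two_left (k m : ℕ) :
    hittingProb (k + 2) m = 2 * hittingProb (k + 1) (m + 1) - hittingProb k (m + 1) := by
  unfold hittingProb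
  rw [show k + 2 + 2 * m = k + 2 * m + 2 by ring,
    show k + 2 + 1 + 2 * m = k + 2 * m + 3 by ring, show k + 2 + 1 + m = k + m + 3 by ring,
    show k + 1 + 2 * (m + 1) = k + 2 * m + 3 by ring,
    show k + 1 + 1 + 2 * (m + 1) = k + 2 * m + 4 by ring,
    show k + 1 + 1 + (m + 1) = k + m + 3 by ring,
    show k + 2 * (m + 1) = k + 2 * m + 2 by ring,
    show k + 1 + (m + 1) = k + m + 2 by ring]
  simp only [Nat.factorial_succ, pow_succ]
  push_cast
  field_simp
  ring

lemma hasSum_hittingProb (k : ℕ) : HasSum (hittingProb k) 1 := by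
  have zero : HasSum (hittingProb 0) 1 := by
    rw [hasSum_iff_tendsto_nat_of_nonneg (hittingProb_nonneg 0)]
    simp_rw [hittingProb_zero_left, Finset.sum_range_sub']
    simpa [returnProb] using tendsto_returnProb.const_sub (returnProb 0)
  have tail {k : ℕ} (h : HasSum (hittingProb k) 1) :
      HasSum (fun m => hittingProb k (m + 1)) (1 - (1 / 2) ^ (k + 1)) := by
    rw [← hittingProb_zero_right]
    simpa using (hasSum_nat_add_iff' 1).2 h
  induction k using Nat.twoStepInduction with
  | zero => exact zero
  | one =>
    rw [funext hittingProb_one_left,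
      show (1 : ℝ) = 2 * (1 - (1 / 2) ^ (0 + 1)) by norm_num]
    exact (tail zero).mul_left 2
  | more k h₀ h₁ =>
    rw [funext (hittingProb_add_two_left k),
      show (1 : ℝ) = 2 * (1 - (1 / 2) ^ (k + 1 + 1)) - (1 - (1 / 2) ^ (k + 1)) by ring]
    exact ((tail h₁).mul_left 2).sub (tail h₀)

lemma integrableOn_exp_neg_mul_pow (n : ℕ) :
    IntegrableOn (fun t : ℝ => Real.exp (-t) * t ^ n) (Set.Ioi 0) := by
  simpa using Real.GammaIntegral_convergent (s := n + 1) (by positivity)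

lemma integral_exp_neg_mul_pow (n : ℕ) :
    ∫ t in Set.Ioi (0 : ℝ), Real.exp (-t) * t ^ n = n.factorial := by
  simpa [Real.Gamma_nat_eq_factorial] using
    (Real.Gamma_eq_integral (s := n + 1) (by positivity)).symm

lemma exp_neg_mul_besselI_div {t : ℝ} (ht : 0 < t) (k : ℕ) :
    Real.exp (-t) * besselI (k + 1) t / t =
      ∑' m : ℕ, hittingProb k m / ((k + 1) * (k + 2 * m).factorial) *
        (Real.exp (-t) * t ^ (k + 2 * m)) := by
  unfold besselI
  rw [← tsum_mul_left, ← tsum_div_const]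
  congr 1 with m
  unfold hittingProb
  rw [show k + 1 + 2 * m = k + 2 * m + 1 by ring, div_pow, pow_succ t]
  field_simp

lemma integral_exp_neg_mul_besselI_div (k : ℕ) :
    ∫ t in Set.Ioi (0 : ℝ), Real.exp (-t) * besselI (k + 1) t / t = 1 / ((k : ℝ) + 1) := by
  rw [setIntegral_congr_fun measurableSet_Ioi
    fun t (ht : 0 < t) => exp_neg_mul_besselI_div ht k]
  have hc (m : ℕ) : 0 ≤ hittingProb k m / ((k + 1) * (k + 2 * m).factorial) :=
    div_nonneg (hittingProb_nonneg k m) (by positivity)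
  have hint (m : ℕ) : ∫ t in Set.Ioi (0 : ℝ),
      hittingProb k m / ((k + 1) * (k + 2 * m).factorial) *
        (Real.exp (-t) * t ^ (k + 2 * m)) = hittingProb k m / (k + 1) := by
    rw [integral_const_mul, integral_exp_neg_mul_pow]
    field_simp
  have hsum := (hasSum_hittingProb k).div_const ((k : ℝ) + 1)
  refine HasSum.unique (hasSum_integral_of_summable_integral_norm
    (fun m => (integrableOn_exp_neg_mul_pow (k + 2 * m)).const_mul _) ?_) ?_
  · refine hsum.summable.congr fun m => ?_
    rw [← hint m]
    refine setIntegral_congr_fun measurableSet_Ioi fun t (ht : 0 < t) => ?_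
    exact (Real.norm_of_nonneg (mul_nonneg (hc m) (by positivity))).symm
  · simpa only [hint] using hsum

theorem firstPassage_density_integrates_to_one (ℓ : ℕ) (hℓ : 1 ≤ ℓ) :
    IntegrableOn (fun t : ℝ => Real.exp (-t) * besselI ℓ t / t) (Set.Ioi 0) ∧
    (∫ t in Set.Ioi (0 : ℝ), Real.exp (-t) * besselI ℓ t / t) = 1 / ℓ ∧
    (∫ t in Set.Ioi (0 : ℝ), Real.exp (-t) * ((ℓ : ℝ) / t) * besselI ℓ t) = 1 := by
  have hpos : (0 : ℝ) < ℓ := by exact_mod_cast hℓ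
  have key : ∫ t in Set.Ioi (0 : ℝ), Real.exp (-t) * besselI ℓ t / t = 1 / ℓ := by
    obtain ⟨k, rfl⟩ := Nat.exists_eq_add_of_le' hℓ
    simpa using integral_exp_neg_mul_besselI_div k
  refine ⟨Integrable.of_integral_ne_zero (by rw [key]; positivity), key, ?_⟩
  calc ∫ t in Set.Ioi (0 : ℝ), Real.exp (-t) * ((ℓ : ℝ) / t) * besselI ℓ t
      = ∫ t in Set.Ioi (0 : ℝ), (ℓ : ℝ) * (Real.exp (-t) * besselI ℓ t / t) := by
        congr 1 with t
        ring
    _ = 1 := by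
        rw [integral_const_mul, key]
        field_simp
end

section
/- For every integer n ≥ 1 and every real s, one has n · I_n(s) = (s/π) ∫_0^π e^{s cos θ} sin θ · sin(nθ) dθ. -/
open MeasureTheory Real

theorem integral_cos_int_mul_eq_zero {n : ℤ} (hn : n ≠ 0) :
    ∫ θ in (0 : ℝ)..π, cos (n * θ) = 0 := by
  have hn' : (n : ℝ) ≠ 0 := by exact_mod_cast hn
  rw [intervalIntegral.integral_comp_mul_left (fun x => cos x) hn', integral_cos]
  simp [sin_int_mul_pi]

theorem integral_cos_pow_succ_mul_cos_int_mul (k : ℕ) (n : ℤ) :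
    ∫ θ in (0 : ℝ)..π, cos θ ^ (k + 1) * cos (n * θ) =
      ((∫ θ in (0 : ℝ)..π, cos θ ^ k * cos ((n - 1 : ℤ) * θ)) +
        ∫ θ in (0 : ℝ)..π, cos θ ^ k * cos ((n + 1 : ℤ) * θ)) / 2 := by
  rw [← intervalIntegral.integral_add (Continuous.intervalIntegrable (by fun_prop) _ _)
    (Continuous.intervalIntegrable (by fun_prop) _ _), ← intervalIntegral.integral_div]
  congr 1
  ext θ
  push_cast
  rw [sub_mul, add_mul, one_mul, cos_sub, cos_add]
  ring

theorem integral_cos_pow_mul_cos_int_mul_of_lt {k : ℕ} {n : ℤ} (h : (k : ℤ) < n) :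
    ∫ θ in (0 : ℝ)..π, cos θ ^ k * cos (n * θ) = 0 := by
  induction k generalizing n with
  | zero =>
    simp only [pow_zero, one_mul]
    exact integral_cos_int_mul_eq_zero (by lia)
  | succ k ih =>
    rw [integral_cos_pow_succ_mul_cos_int_mul, ih (by lia), ih (by lia)]
    simp

theorem integral_cos_pow_mul_cos_int_mul_of_odd {k : ℕ} {n : ℤ} (h : Odd (k + n)) :
    ∫ θ in (0 : ℝ)..π, cos θ ^ k * cos (n * θ) = 0 := by
  induction k generalizing n with
  | zero =>
    simp only [pow_zero, one_mul]
    refine integral_cos_int_mul_eq_zero ?_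
    rintro rfl
    simp at h
  | succ k ih =>
    rw [integral_cos_pow_succ_mul_cos_int_mul, ih (by grind), ih (by grind)]
    simp

theorem integral_cos_pow_mul_cos_sub_two_mul (k j : ℕ) :
    ∫ θ in (0 : ℝ)..π, cos θ ^ k * cos ((k - 2 * j : ℤ) * θ) = π / 2 ^ k * k.choose j := by
  induction k generalizing j with
  | zero =>
    cases j with
    | zero => simp
    | succ j =>
      have h := integral_cos_int_mul_eq_zero (n := ((0 : ℕ) : ℤ) - 2 * ((j + 1 : ℕ) : ℤ)) (by lia)
      push_cast at h
      simpa using h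
  | succ k ih =>
    have key := integral_cos_pow_succ_mul_cos_int_mul k (((k + 1 : ℕ) : ℤ) - 2 * (j : ℤ))
    have h₁ := ih j
    rw [show ((k + 1 : ℕ) : ℤ) - 2 * (j : ℤ) - 1 = k - 2 * j by push_cast; ring] at key
    cases j with
    | zero =>
      rw [integral_cos_pow_mul_cos_int_mul_of_lt (n := _ + 1) (by lia)] at key
      push_cast at key h₁ ⊢
      rw [key, h₁]
      simp only [Nat.choose_zero_right]
      field_simp
      ring
    | succ j =>
      have h₂ := ih j
      rw [show ((k + 1 : ℕ) : ℤ) - 2 * ((j + 1 : ℕ) : ℤ) + 1 = k - 2 * j by push_cast; ring] at key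
      push_cast at key h₁ h₂ ⊢
      rw [key, h₁, h₂, Nat.choose_succ_succ]
      push_cast
      field_simp
      ring

theorem hasSum_integral_exp_mul_cos_mul_cos (s : ℝ) (n : ℕ) :
    HasSum (fun k : ℕ => s ^ k / k.factorial * ∫ θ in (0 : ℝ)..π, cos θ ^ k * cos (n * θ))
      (∫ θ in (0 : ℝ)..π, exp (s * cos θ) * cos (n * θ)) := by
  have h := intervalIntegral.hasSum_integral_of_dominated_convergence (μ := volume)
    (a := 0) (b := π)
    (F := fun (k : ℕ) (θ : ℝ) => s ^ k / k.factorial * (cos θ ^ k * cos (n * θ)))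
    (f := fun θ => exp (s * cos θ) * cos (n * θ))
    (fun k _ => |s| ^ k / k.factorial)
    (fun k => Continuous.aestronglyMeasurable (by fun_prop))
    (fun k => .of_forall fun θ _ => by
      rw [norm_mul, norm_mul, norm_div, norm_pow, norm_pow]
      simp only [Real.norm_eq_abs, Nat.abs_cast]
      refine mul_le_of_le_one_right (by positivity) ?_
      exact mul_le_one₀ (pow_le_one₀ (abs_nonneg _) (abs_cos_le_one θ)) (abs_nonneg _)
        (abs_cos_le_one _))
    (.of_forall fun θ _ => Real.summable_pow_div_factorial |s|)
    (by simp)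
    (.of_forall fun θ _ => by
      have := (NormedSpace.expSeries_div_hasSum_exp (s * cos θ)).mul_right (cos (n * θ))
      rw [← Real.exp_eq_exp_ℝ] at this
      refine this.congr_fun ?_
      intro k
      rw [mul_pow]
      ring)
  simpa only [intervalIntegral.integral_const_mul] using h

theorem integral_exp_mul_cos_mul_cos (s : ℝ) (n : ℕ) :
    ∫ θ in (0 : ℝ)..π, exp (s * cos θ) * cos (n * θ) = π * besselI n s := by
  have h := hasSum_integral_exp_mul_cos_mul_cos s n
  have hinj : Function.Injective fun m : ℕ => n + 2 * m := fun a b hab => by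
    simp only at hab
    lia
  rw [← hinj.hasSum_iff] at h
  · rw [← h.tsum_eq, besselI, ← tsum_mul_left]
    congr 1
    ext m
    have hm := integral_cos_pow_mul_cos_sub_two_mul (n + 2 * m) m
    have hc := Nat.add_choose_mul_factorial_mul_factorial (n + m) m
    rw [show n + m + m = n + 2 * m by ring] at hc
    push_cast at hm
    simp only [add_sub_cancel_right] at hm
    simp only [Function.comp_apply]
    rw [hm, ← hc, div_pow]
    have : ((n + 2 * m).choose m : ℝ) ≠ 0 := by
      exact_mod_cast (Nat.choose_pos (by lia)).ne'
    push_cast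
    field_simp
  · intro k hk
    rcases lt_or_ge k n with hkn | hkn
    · have := integral_cos_pow_mul_cos_int_mul_of_lt (k := k) (n := n) (by lia)
      push_cast at this
      rw [this, mul_zero]
    · have hodd : Odd ((k : ℤ) + n) := by
        by_contra hne
        rw [Int.not_odd_iff_even] at hne
        obtain ⟨r, hr⟩ := hne
        exact hk ⟨(k - n) / 2, by simp only; lia⟩
      have := integral_cos_pow_mul_cos_int_mul_of_odd hodd
      push_cast at this
      rw [this, mul_zero]

theorem mul_integral_exp_mul_cos_mul_sin_mul_sin (s : ℝ) (n : ℕ) :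
    s * ∫ θ in (0 : ℝ)..π, exp (s * cos θ) * sin θ * sin (n * θ) =
      n * ∫ θ in (0 : ℝ)..π, exp (s * cos θ) * cos (n * θ) := by
  have h := intervalIntegral.integral_mul_deriv_eq_deriv_mul (a := 0) (b := π)
    (u := fun θ => sin (n * θ)) (u' := fun θ => cos (n * θ) * (n * 1))
    (v := fun θ => exp (s * cos θ)) (v' := fun θ => exp (s * cos θ) * (s * -sin θ))
    (fun θ _ => ((hasDerivAt_id θ).const_mul (n : ℝ)).sin)
    (fun θ _ => ((hasDerivAt_cos θ).const_mul s).exp)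
    (Continuous.intervalIntegrable (by fun_prop) _ _)
    (Continuous.intervalIntegrable (by fun_prop) _ _)
  simp only [sin_nat_mul_pi, mul_zero, sin_zero, zero_mul, sub_zero, zero_sub] at h
  rw [← intervalIntegral.integral_const_mul, ← intervalIntegral.integral_const_mul]
  rw [← neg_inj, ← intervalIntegral.integral_neg]
  calc _ = _ := intervalIntegral.integral_congr fun θ _ => by ring
    _ = _ := h
    _ = _ := congrArg _ (intervalIntegral.integral_congr fun θ _ => by ring)

theorem besselI_sine_integral_rep (n : ℕ) (hn : 1 ≤ n) (s : ℝ) :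
    (n : ℝ) * besselI n s = (s / Real.pi) * ∫ θ in (0 : ℝ)..Real.pi,
      Real.exp (s * Real.cos θ) * Real.sin θ * Real.sin (n * θ) := by
  rw [div_mul_eq_mul_div, mul_integral_exp_mul_cos_mul_sin_mul_sin, integral_exp_mul_cos_mul_cos]
  field_simp
end

section
/- For every integer ℓ ≥ 1, every real p ≥ 1 and every real t ≥ 0, the tail integral satisfies ℓ ∫_t^∞ e^{-ps} I_ℓ(s) / s ds = (e^{-pt}/π) ∫_0^π [sin θ · sin(ℓθ) / (p − cos θ)] e^{t cos θ} dθ. -/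
open MeasureTheory Real

theorem abs_sin_natCast_mul_le (n : ℕ) (θ : ℝ) : |sin (n * θ)| ≤ n * |sin θ| := by
  induction n with
  | zero => simp
  | succ n ih =>
    have h : sin ((n + 1 : ℕ) * θ) = sin (n * θ) * cos θ + cos (n * θ) * sin θ := by
      rw [← sin_add]; push_cast; ring_nf
    rw [h]
    calc _ ≤ |sin (n * θ)| * |cos θ| + |cos (n * θ)| * |sin θ| := by
          simpa only [abs_mul] using abs_add_le (sin (n * θ) * cos θ) (cos (n * θ) * sin θ)
      _ ≤ |sin (n * θ)| * 1 + 1 * |sin θ| := by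
          gcongr
          · exact abs_cos_le_one θ
          · exact abs_cos_le_one _
      _ ≤ (n + 1 : ℕ) * |sin θ| := by push_cast; linarith

theorem integral_cos_intCast_mul (n : ℤ) :
    ∫ θ in (0 : ℝ)..π, cos (n * θ) = if n = 0 then π else 0 := by
  split_ifs with h
  · simp [h]
  · have hn : (n : ℝ) ≠ 0 := Int.cast_ne_zero.mpr h
    rw [intervalIntegral.integral_comp_mul_left (fun x => cos x) hn]
    simp [sin_int_mul_pi]

theorem integral_cos_intCast_mul_mul_cos (m n : ℤ) :
    ∫ θ in (0 : ℝ)..π, cos (m * θ) * cos (n * θ)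
      = (if m = n then π / 2 else 0) + (if m = -n then π / 2 else 0) := by
  have h (θ : ℝ) : cos (m * θ) * cos (n * θ)
      = cos ((m - n : ℤ) * θ) / 2 + cos ((m + n : ℤ) * θ) / 2 := by
    push_cast
    rw [sub_mul, add_mul, cos_sub, cos_add]
    ring
  simp_rw [h]
  rw [intervalIntegral.integral_add
    (Continuous.intervalIntegrable (by fun_prop) _ _)
    (Continuous.intervalIntegrable (by fun_prop) _ _),
    intervalIntegral.integral_div, intervalIntegral.integral_div,
    integral_cos_intCast_mul, integral_cos_intCast_mul]
  simp only [sub_eq_zero, ← eq_neg_iff_add_eq_zero]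
  split_ifs <;> simp

theorem summable_norm_pow_div_factorial_mul (x : ℝ) :
    Summable fun q : ℕ × ℕ => ‖x ^ q.1 / q.1.factorial * (x ^ q.2 / q.2.factorial)‖ := by
  have h : Summable fun n : ℕ => ‖x ^ n / n.factorial‖ := NormedSpace.norm_expSeries_div_summable x
  have h' := h.mul_norm h
  exact h'

theorem hasSum_exp_mul_cos (s θ : ℝ) :
    HasSum (fun q : ℕ × ℕ => (s / 2) ^ q.1 / q.1.factorial * ((s / 2) ^ q.2 / q.2.factorial)
      * cos (((q.1 : ℤ) - (q.2 : ℤ) : ℤ) * θ)) (exp (s * cos θ)) := by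
  have key (z w : ℂ) : HasSum (fun q : ℕ × ℕ => z ^ q.1 / q.1.factorial *
      (w ^ q.2 / q.2.factorial)) (Complex.exp (z + w)) := by
    rw [Complex.exp_add, Complex.exp_eq_exp_ℂ]
    have h (z : ℂ) : Summable fun n : ℕ => ‖z ^ n / n.factorial‖ :=
      NormedSpace.norm_expSeries_div_summable z
    have h' (z : ℂ) : HasSum (fun n : ℕ => z ^ n / n.factorial) (NormedSpace.exp z) :=
      NormedSpace.expSeries_div_hasSum_exp z
    have hzw := summable_mul_of_summable_norm (h z) (h w)
    have hmul := (h' z).mul (h' w) hzw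
    exact hmul
  have h := Complex.hasSum_re (key ((s / 2 : ℝ) * Complex.exp (θ * Complex.I))
    ((s / 2 : ℝ) * Complex.exp (-θ * Complex.I)))
  convert! h using 1
  · ext q
    have : ((s / 2 : ℝ) * Complex.exp (θ * Complex.I)) ^ q.1 / q.1.factorial *
        (((s / 2 : ℝ) * Complex.exp (-θ * Complex.I)) ^ q.2 / q.2.factorial)
        = (((s / 2) ^ q.1 / q.1.factorial * ((s / 2) ^ q.2 / q.2.factorial) : ℝ) : ℂ)
          * Complex.exp (((((q.1 : ℤ) - (q.2 : ℤ) : ℤ) * θ : ℝ) : ℂ) * Complex.I) := by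
      have e : Complex.exp (((((q.1 : ℤ) - (q.2 : ℤ) : ℤ) * θ : ℝ) : ℂ) * Complex.I)
          = Complex.exp (θ * Complex.I) ^ q.1 * Complex.exp (-θ * Complex.I) ^ q.2 := by
        rw [← Complex.exp_nat_mul, ← Complex.exp_nat_mul, ← Complex.exp_add]
        push_cast
        ring_nf
      rw [e]
      push_cast
      ring
    rw [this, Complex.re_ofReal_mul, Complex.exp_ofReal_mul_I_re]
  · have : (s / 2 : ℝ) * Complex.exp (θ * Complex.I) + (s / 2 : ℝ) * Complex.exp (-θ * Complex.I)
        = ((s * cos θ : ℝ) : ℂ) := by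
      push_cast
      rw [Complex.cos]
      ring
    rw [this, Complex.exp_ofReal_re]

theorem hasSum_besselI (n : ℕ) (x : ℝ) :
    HasSum (fun m : ℕ => (x / 2) ^ (n + m) / (n + m).factorial * ((x / 2) ^ m / m.factorial))
      (besselI n x) := by
  have hs : Summable fun m : ℕ =>
      (x / 2) ^ (n + m) / (n + m).factorial * ((x / 2) ^ m / m.factorial) :=
    (summable_norm_pow_div_factorial_mul (x / 2)).of_norm.comp_injective
      (i := fun m : ℕ => (n + m, m)) (fun a b h => (Prod.ext_iff.mp h).2)
  convert! hs.hasSum using 1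
  refine tsum_congr fun m => ?_
  rw [div_mul_div_comm, ← pow_add, mul_comm (m.factorial : ℝ)]
  ring_nf

theorem integral_cos_mul_exp (n : ℕ) (s : ℝ) :
    ∫ θ in (0 : ℝ)..π, cos (n * θ) * exp (s * cos θ) = π * besselI n s := by
  set a : ℕ × ℕ → ℝ := fun q => (s / 2) ^ q.1 / q.1.factorial * ((s / 2) ^ q.2 / q.2.factorial)
    with ha
  have hsum : Summable fun q => ‖a q‖ := summable_norm_pow_div_factorial_mul (s / 2)
  have h := intervalIntegral.hasSum_integral_of_dominated_convergence (μ := volume)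
    (a := 0) (b := π) (F := fun (q : ℕ × ℕ) θ => cos (n * θ) *
      (a q * cos (((q.1 : ℤ) - (q.2 : ℤ) : ℤ) * θ)))
    (f := fun θ => cos (n * θ) * exp (s * cos θ)) (fun q _ => ‖a q‖)
    (fun q => Continuous.aestronglyMeasurable (by fun_prop))
    (fun q => Filter.Eventually.of_forall fun θ _ => by
      rw [norm_mul, norm_mul]
      calc _ ≤ 1 * (‖a q‖ * 1) := by
            gcongr
            · exact abs_cos_le_one _
            · exact abs_cos_le_one _
        _ = ‖a q‖ := by ring)
    (Filter.Eventually.of_forall fun θ _ => hsum)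
    intervalIntegrable_const
    (Filter.Eventually.of_forall fun θ _ => (hasSum_exp_mul_cos s θ).mul_left _)
  have hint (q : ℕ × ℕ) : ∫ θ in (0 : ℝ)..π, cos (n * θ) *
      (a q * cos (((q.1 : ℤ) - (q.2 : ℤ) : ℤ) * θ))
      = a q * (if q.1 = n + q.2 then π / 2 else 0) + a q * (if q.2 = n + q.1 then π / 2 else 0) := by
    have e := integral_cos_intCast_mul_mul_cos n ((q.1 : ℤ) - (q.2 : ℤ))
    simp_rw [mul_left_comm _ (a q)]
    rw [intervalIntegral.integral_const_mul, ← mul_add]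
    congr 1
    simp only [Int.cast_natCast] at e
    rw [e]
    congr 2 <;> simp only [eq_iff_iff] <;> omega
  simp_rw [hint] at h
  have h1 : HasSum (fun q : ℕ × ℕ => a q * (if q.1 = n + q.2 then π / 2 else 0))
      (besselI n s * (π / 2)) := by
    have hi : Function.Injective (fun m : ℕ => (n + m, m)) := fun a b h => (Prod.ext_iff.mp h).2
    rw [← hi.hasSum_iff]
    · simpa [Function.comp_def, ha] using (hasSum_besselI n s).mul_right (π / 2)
    · rintro ⟨j, m⟩ hq
      rw [if_neg, mul_zero]
      intro hj
      exact hq ⟨m, Prod.ext hj.symm rfl⟩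
  have h2 : HasSum (fun q : ℕ × ℕ => a q * (if q.2 = n + q.1 then π / 2 else 0))
      (besselI n s * (π / 2)) := by
    rw [← (Equiv.prodComm ℕ ℕ).hasSum_iff]
    convert! h1 using 2 with q
    simp [ha, mul_comm]
  rw [h.unique (h1.add h2)]
  ring

theorem integral_sin_mul_sin_mul_exp (n : ℕ) (s : ℝ) :
    s * ∫ θ in (0 : ℝ)..π, sin θ * sin (n * θ) * exp (s * cos θ) = n * (π * besselI n s) := by
  have hd (θ : ℝ) : HasDerivAt (fun θ => sin (n * θ) * exp (s * cos θ))
      (n * (cos (n * θ) * exp (s * cos θ)) - s * (sin θ * sin (n * θ) * exp (s * cos θ))) θ := by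
    have h1 : HasDerivAt (fun θ => sin (n * θ)) (cos (n * θ) * (n * 1)) θ :=
      ((hasDerivAt_id θ).const_mul (n : ℝ)).sin
    have h2 : HasDerivAt (fun θ => exp (s * cos θ)) (exp (s * cos θ) * (s * -sin θ)) θ :=
      ((hasDerivAt_cos θ).const_mul s).exp
    convert! h1.mul h2 using 1
    ring
  have h := intervalIntegral.integral_eq_sub_of_hasDerivAt (a := 0) (b := π) (fun θ _ => hd θ)
    (Continuous.intervalIntegrable (by fun_prop) _ _)
  rw [intervalIntegral.integral_sub (Continuous.intervalIntegrable (by fun_prop) _ _)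
    (Continuous.intervalIntegrable (by fun_prop) _ _), intervalIntegral.integral_const_mul,
    intervalIntegral.integral_const_mul, integral_cos_mul_exp n] at h
  simp only [sin_nat_mul_pi, zero_mul, mul_zero, sin_zero, sub_zero] at h
  linarith

theorem cos_lt_of_mem_Ioc {p θ : ℝ} (hp : 1 ≤ p) (hθ : θ ∈ Set.Ioc 0 π) : cos θ < p := by
  have := cos_lt_cos_of_nonneg_of_le_pi le_rfl hθ.2 hθ.1
  rw [cos_zero] at this
  linarith

theorem abs_sin_mul_sin_div_le (n : ℕ) {p θ : ℝ} (hp : 1 ≤ p) (hθ : θ ∈ Set.Ioc 0 π) :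
    |sin θ * sin (n * θ)| / (p - cos θ) ≤ 2 * n := by
  have hpos := sub_pos.mpr (cos_lt_of_mem_Ioc hp hθ)
  rw [div_le_iff₀ hpos, abs_mul]
  calc |sin θ| * |sin (n * θ)| ≤ |sin θ| * (n * |sin θ|) := by
        gcongr
        exact abs_sin_natCast_mul_le n θ
    _ = n * ((1 + cos θ) * (1 - cos θ)) := by
        linear_combination (n : ℝ) * sq_abs (sin θ) + (n : ℝ) * sin_sq_add_cos_sq θ
    _ ≤ n * (2 * (p - cos θ)) := by
        have := cos_le_one θ
        gcongr; linarith
    _ = _ := by ring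

theorem integrable_sin_mul_sin_mul_exp (n : ℕ) {p t : ℝ} (hp : 1 ≤ p) (ht : 0 ≤ t) :
    Integrable (Function.uncurry fun s θ : ℝ =>
      sin θ * sin (n * θ) * exp (-(p - cos θ) * s))
      ((volume.restrict (Set.Ioi t)).prod (volume.restrict (Set.Ioc 0 π))) := by
  have hm : Continuous (Function.uncurry fun s θ : ℝ =>
      sin θ * sin (n * θ) * exp (-(p - cos θ) * s)) := by
    unfold Function.uncurry; fun_prop
  rw [integrable_prod_iff' hm.aestronglyMeasurable]
  have hneg {θ : ℝ} (hθ : θ ∈ Set.Ioc 0 π) : -(p - cos θ) < 0 :=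
    neg_lt_zero.mpr (sub_pos.mpr (cos_lt_of_mem_Ioc hp hθ))
  constructor
  · filter_upwards [ae_restrict_mem measurableSet_Ioc] with θ hθ
    exact Integrable.const_mul (integrableOn_exp_mul_Ioi (hneg hθ) t) (sin θ * sin (n * θ))
  · refine Integrable.of_bound (C := 2 * n)
      hm.norm.stronglyMeasurable.integral_prod_left.aestronglyMeasurable ?_
    filter_upwards [ae_restrict_mem measurableSet_Ioc] with θ hθ
    have hpos := sub_pos.mpr (cos_lt_of_mem_Ioc hp hθ)
    simp only [Function.uncurry_apply_pair, norm_mul, norm_eq_abs, abs_exp]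
    rw [integral_const_mul, integral_exp_mul_Ioi (hneg hθ), neg_div_neg_eq,
      ← abs_mul, abs_of_nonneg (by positivity)]
    calc |sin θ * sin (n * θ)| * (exp (-(p - cos θ) * t) / (p - cos θ))
        = |sin θ * sin (n * θ)| / (p - cos θ) * exp (-(p - cos θ) * t) := by ring
      _ ≤ |sin θ * sin (n * θ)| / (p - cos θ) * 1 := by
          gcongr
          rw [exp_le_one_iff, neg_mul]
          exact neg_nonpos.mpr (by positivity)
      _ ≤ 2 * n := by
          rw [mul_one]
          exact abs_sin_mul_sin_div_le n hp hθ

theorem tail_integral_besselI (ℓ : ℕ) (hℓ : 1 ≤ ℓ) (p : ℝ) (hp : 1 ≤ p) (t : ℝ) (ht : 0 ≤ t) :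
    (ℓ : ℝ) * ∫ s in Set.Ioi t, Real.exp (-p * s) * besselI ℓ s / s
      = (Real.exp (-p * t) / Real.pi) * ∫ θ in (0 : ℝ)..Real.pi,
          Real.sin θ * Real.sin (ℓ * θ) / (p - Real.cos θ) * Real.exp (t * Real.cos θ) := by
  have hrep : ∀ s ∈ Set.Ioi t, (ℓ : ℝ) * (exp (-p * s) * besselI ℓ s / s)
      = π⁻¹ * ∫ θ in Set.Ioc 0 π, sin θ * sin (ℓ * θ) * exp (-(p - cos θ) * s) := by
    intro s hs
    have hs0 : s ≠ 0 := (ht.trans_lt hs).ne'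
    have hexp (θ : ℝ) : sin θ * sin (ℓ * θ) * exp (-(p - cos θ) * s)
        = exp (-p * s) * (sin θ * sin (ℓ * θ) * exp (s * cos θ)) := by
      rw [show -(p - cos θ) * s = -p * s + s * cos θ by ring, exp_add]
      ring
    simp_rw [hexp]
    rw [integral_const_mul, ← intervalIntegral.integral_of_le pi_pos.le]
    have h := integral_sin_mul_sin_mul_exp ℓ s
    field_simp
    linear_combination -h
  rw [← integral_const_mul, setIntegral_congr_fun measurableSet_Ioi hrep, integral_const_mul,
    integral_integral_swap (integrable_sin_mul_sin_mul_exp ℓ hp ht),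
    intervalIntegral.integral_of_le pi_pos.le, div_eq_inv_mul, mul_assoc]
  congr 1
  rw [← integral_const_mul]
  refine setIntegral_congr_fun measurableSet_Ioc fun θ hθ => ?_
  have hpos := sub_pos.mpr (cos_lt_of_mem_Ioc hp hθ)
  rw [integral_const_mul, integral_exp_mul_Ioi (neg_lt_zero.mpr hpos), neg_div_neg_eq,
    show -(p - cos θ) * t = -p * t + t * cos θ by ring, exp_add]
  ring
end

section
/- For every integer ℓ ≥ 1 and every real x, one has 2^{−ℓ} ∑_{n=0}^∞ [(ℓ/2)_n · ((ℓ+1)/2)_n / (n! · (ℓ+1)_n)] · x^{ℓ+2n}/(ℓ+2n−1)! = ℓ · ∑_{n=0}^∞ (x/2)^{ℓ+2n} / (n! · (ℓ+n)!), where (a)_n denotes the Pochhammer symbol; i.e. the first-passage series equals ℓ · I_ℓ(x) with I_ℓ the modified Bessel function of the first kind. -/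
open MeasureTheory Real

theorem ascPochhammer_eval_two_mul (a : ℝ) (n : ℕ) :
    (ascPochhammer ℝ (2 * n)).eval a =
      4 ^ n * ((ascPochhammer ℝ n).eval (a / 2) * (ascPochhammer ℝ n).eval ((a + 1) / 2)) := by
  induction n with
  | zero => simp
  | succ n ih =>
    rw [show 2 * (n + 1) = 2 * n + 1 + 1 by ring]
    simp only [ascPochhammer_succ_eval]
    rw [ih]
    push_cast
    ring

theorem factorial_mul_ascPochhammer_eval (m n : ℕ) :
    (m.factorial : ℝ) * (ascPochhammer ℝ n).eval ((m : ℝ) + 1) = ((m + n).factorial : ℝ) := by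
  rw [← Nat.factorial_mul_ascFactorial, Nat.cast_mul, ← ascPochhammer_nat_eq_ascFactorial,
    ascPochhammer_eval_cast]
  push_cast
  rfl

theorem firstPassage_series_eq_besselI (ℓ : ℕ) (hℓ : 1 ≤ ℓ) (x : ℝ) :
    (2 : ℝ) ^ (-(ℓ : ℤ)) *
      ∑' n : ℕ,
        ((ascPochhammer ℝ n).eval ((ℓ : ℝ) / 2) *
            (ascPochhammer ℝ n).eval (((ℓ : ℝ) + 1) / 2) /
          ((n.factorial : ℝ) * (ascPochhammer ℝ n).eval ((ℓ : ℝ) + 1))) *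
        x ^ (ℓ + 2 * n) / ((ℓ + 2 * n - 1).factorial : ℝ)
      = (ℓ : ℝ) * besselI ℓ x := by
  obtain ⟨k, rfl⟩ : ∃ k, ℓ = k + 1 := ⟨ℓ - 1, by omega⟩
  rw [besselI, ← tsum_mul_left, ← tsum_mul_left]
  refine tsum_congr fun n => ?_
  have hdup := ascPochhammer_eval_two_mul ((k + 1 : ℕ) : ℝ) n
  have hnum := factorial_mul_ascPochhammer_eval k (2 * n)
  have hden := factorial_mul_ascPochhammer_eval (k + 1) n
  rw [← Nat.cast_succ, hdup] at hnum
  have hpoch : (ascPochhammer ℝ n).eval (((k + 1 : ℕ) : ℝ) + 1) ≠ 0 :=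
    (ascPochhammer_pos n _ (by positivity)).ne'
  have hk : (k.factorial : ℝ) ≠ 0 := by positivity
  have hn : (n.factorial : ℝ) ≠ 0 := by positivity
  have hpow : (2 : ℝ) ^ (k + 1 + 2 * n) = 2 ^ (k + 1) * 4 ^ n := by
    rw [pow_add, pow_mul]; norm_num
  have hprod : (ascPochhammer ℝ n).eval (((k + 1 : ℕ) : ℝ) / 2) *
      (ascPochhammer ℝ n).eval ((((k + 1 : ℕ) : ℝ) + 1) / 2) ≠ 0 :=
    mul_ne_zero (ascPochhammer_pos n _ (by positivity)).ne'
      (ascPochhammer_pos n _ (by positivity)).ne'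
  rw [show k + 1 + 2 * n - 1 = k + 2 * n by omega, ← hnum, ← hden, div_pow, hpow, zpow_neg,
    zpow_natCast, Nat.factorial_succ, Nat.cast_mul]
  generalize (ascPochhammer ℝ n).eval (((k + 1 : ℕ) : ℝ) / 2) *
      (ascPochhammer ℝ n).eval ((((k + 1 : ℕ) : ℝ) + 1) / 2) = p at *
  generalize (ascPochhammer ℝ n).eval (((k + 1 : ℕ) : ℝ) + 1) = q at *
  have hc : ((k + 1 : ℕ) : ℝ) ≠ 0 := by positivity
  generalize ((k + 1 : ℕ) : ℝ) = c at *
  field_simp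
end

section
/- Fix a positive integer ℓ_B. Then, as ℓ_A → ∞ through the positive integers, P(ℓ_A, ℓ_B) − (2ℓ_B)/(π ℓ_A) = O(ℓ_A^{−3}); in particular ℓ_A · P(ℓ_A, ℓ_B) converges to 2ℓ_B/π. -/
open MeasureTheory Real Filter Asymptotics

/-- Probability that walker `A` first reaches site `a` before walker `B` first reaches `b`. -/
noncomputable def Pfirst (a b : ℕ) : ℝ :=
  (a : ℝ) * (b : ℝ) * ∫ tA in Set.Ioi (0 : ℝ),
    (Real.exp (-tA) * besselI a tA / tA) *
      ∫ tB in Set.Ioi tA, Real.exp (-tB) * besselI b tB / tB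

theorem hasSum_pow_div_factorial_exp (z : ℂ) :
    HasSum (fun k : ℕ => z ^ k / (k.factorial : ℂ)) (Complex.exp z) := by
  rw [Complex.exp_eq_exp_ℂ]
  exact NormedSpace.expSeries_div_hasSum_exp z

theorem hasSum_exp_mul_exp_mul (z w u : ℂ) :
    HasSum (fun p : ℕ × ℕ => (z ^ p.1 / (p.1.factorial : ℂ)) * (w ^ p.2 / (p.2.factorial : ℂ)) * u)
      (Complex.exp z * Complex.exp w * u) := by
  have hs : Summable fun p : ℕ × ℕ => (z ^ p.1 / (p.1.factorial : ℂ)) *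
      (w ^ p.2 / (p.2.factorial : ℂ)) :=
    summable_mul_of_summable_norm (f := fun k : ℕ => z ^ k / (k.factorial : ℂ))
      (g := fun k : ℕ => w ^ k / (k.factorial : ℂ)) (NormedSpace.norm_expSeries_div_summable z)
      (NormedSpace.norm_expSeries_div_summable w)
  have h := HasSum.mul (f := fun k : ℕ => z ^ k / (k.factorial : ℂ))
      (g := fun k : ℕ => w ^ k / (k.factorial : ℂ))
      (hasSum_pow_div_factorial_exp z) (hasSum_pow_div_factorial_exp w) hs
  exact h.mul_right u

theorem re_exp_series_term (n : ℕ) (x θ : ℝ) (p : ℕ × ℕ) :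
    (((x / 2 : ℝ) * Complex.exp (θ * Complex.I)) ^ p.1 /
        (p.1.factorial : ℂ) * (((x / 2 : ℝ) * Complex.exp (-θ * Complex.I)) ^ p.2 /
        (p.2.factorial : ℂ)) * Complex.exp (-(n * θ) * Complex.I)).re =
      (x / 2) ^ p.1 / (p.1.factorial : ℝ) *
        ((x / 2) ^ p.2 / (p.2.factorial : ℝ)) * cos (((p.1 : ℤ) - p.2 - n : ℤ) * θ) := by
  have he : Complex.exp ((((((p.1 : ℤ) - p.2 - n : ℤ) * θ : ℝ)) : ℂ) * Complex.I) =
      Complex.exp (θ * Complex.I) ^ p.1 * Complex.exp (-θ * Complex.I) ^ p.2 *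
        Complex.exp (-(n * θ) * Complex.I) := by
    rw [← Complex.exp_nat_mul, ← Complex.exp_nat_mul, ← Complex.exp_add, ← Complex.exp_add]
    congr 1
    push_cast
    ring
  rw [← Complex.exp_ofReal_mul_I_re, ← Complex.re_ofReal_mul, he, mul_pow, mul_pow]
  congr 1
  push_cast
  ring

theorem re_exp_mul_exp_mul_exp (n : ℕ) (x θ : ℝ) :
    (Complex.exp ((x / 2 : ℝ) * Complex.exp (θ * Complex.I)) *
      Complex.exp ((x / 2 : ℝ) * Complex.exp (-θ * Complex.I)) *
        Complex.exp (-(n * θ) * Complex.I)).re = exp (x * cos θ) * cos (n * θ) := by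
  rw [← cos_neg (n * θ), ← Complex.exp_ofReal_mul_I_re (-(n * θ)), ← Complex.re_ofReal_mul,
    ← Complex.exp_add, Complex.ofReal_exp, Complex.ofReal_mul x, Complex.ofReal_cos, Complex.cos]
  congr 2
  · congr 1
    push_cast
    ring
  · push_cast
    ring_nf

/-- The expansion of `exp (x cos θ) cos (n θ)` as an absolutely convergent double cosine series. -/
theorem hasSum_exp_mul_cos_s12 (n : ℕ) (x θ : ℝ) :
    HasSum (fun p : ℕ × ℕ => (x / 2) ^ p.1 / (p.1.factorial : ℝ) *
        ((x / 2) ^ p.2 / (p.2.factorial : ℝ)) * cos (((p.1 : ℤ) - p.2 - n : ℤ) * θ))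
      (exp (x * cos θ) * cos (n * θ)) := by
  have h2 := Complex.hasSum_re (hasSum_exp_mul_exp_mul ((x / 2 : ℝ) * Complex.exp (θ * Complex.I))
    ((x / 2 : ℝ) * Complex.exp (-θ * Complex.I)) (Complex.exp (-(n * θ) * Complex.I)))
  rw [re_exp_mul_exp_mul_exp] at h2
  simpa only [re_exp_series_term] using h2

theorem integral_cos_int_mul (k : ℤ) :
    ∫ θ in (0 : ℝ)..π, cos (k * θ) = if k = 0 then π else 0 := by
  split_ifs with h
  · simp [h]
  · have hk : (k : ℝ) ≠ 0 := by exact_mod_cast h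
    rw [intervalIntegral.integral_comp_mul_left (fun y => cos y) hk, integral_cos, sin_int_mul_pi]
    simp

theorem besselI_eq_integral (n : ℕ) (x : ℝ) :
    besselI n x = (1 / π) * ∫ θ in (0 : ℝ)..π, exp (x * cos θ) * cos (n * θ) := by
  have hsummable : Summable fun p : ℕ × ℕ => |x / 2| ^ p.1 / (p.1.factorial : ℝ) *
      (|x / 2| ^ p.2 / (p.2.factorial : ℝ)) :=
    (Real.summable_pow_div_factorial _).mul_of_nonneg (Real.summable_pow_div_factorial _)
      (fun _ => by positivity) (fun _ => by positivity)
  have h := intervalIntegral.hasSum_integral_of_dominated_convergence (μ := volume)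
    (a := 0) (b := π)
    (F := fun (p : ℕ × ℕ) θ => (x / 2) ^ p.1 / (p.1.factorial : ℝ) *
        ((x / 2) ^ p.2 / (p.2.factorial : ℝ)) * cos (((p.1 : ℤ) - p.2 - n : ℤ) * θ))
    (f := fun θ => exp (x * cos θ) * cos (n * θ))
    (fun p _ => |x / 2| ^ p.1 / (p.1.factorial : ℝ) * (|x / 2| ^ p.2 / (p.2.factorial : ℝ)))
    (fun p => by fun_prop)
    (fun p => Eventually.of_forall fun θ _ => by
      rw [norm_mul, norm_mul, norm_div, norm_div, norm_pow, norm_pow, Real.norm_eq_abs,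
        RCLike.norm_natCast, RCLike.norm_natCast]
      exact mul_le_of_le_one_right (by positivity) (abs_cos_le_one _))
    (Eventually.of_forall fun _ _ => hsummable)
    intervalIntegrable_const
    (Eventually.of_forall fun θ _ => hasSum_exp_mul_cos_s12 n x θ)
  simp only [intervalIntegral.integral_const_mul, integral_cos_int_mul] at h
  have hinj : Function.Injective (fun m : ℕ => (m + n, m)) := fun a b hab => by
    simpa using (Prod.ext_iff.mp hab).2
  rw [← hinj.hasSum_iff] at h
  · rw [← h.tsum_eq, besselI, ← tsum_mul_left]
    refine tsum_congr fun m => ?_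
    have : ((m + n : ℕ) : ℤ) - m - n = 0 := by push_cast; ring
    simp only [Function.comp_apply, this, if_true]
    rw [add_comm m n, show n + 2 * m = (n + m) + m by ring, pow_add _ (n + m) m]
    field_simp
  · rintro ⟨j, m⟩ hp
    rw [if_neg, mul_zero]
    intro h0
    exact hp ⟨m, by simp; omega⟩

/-- The exponentially scaled Bessel function `exp (-t) * besselI n t`. -/
noncomputable def scaledBesselI (n : ℕ) (t : ℝ) : ℝ :=
  exp (-t) * besselI n t

theorem scaledBesselI_nonneg (n : ℕ) {t : ℝ} (ht : 0 ≤ t) : 0 ≤ scaledBesselI n t :=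
  mul_nonneg (exp_pos _).le (tsum_nonneg fun m => by positivity)

theorem scaledBesselI_eq_integral (n : ℕ) (t : ℝ) :
    scaledBesselI n t = (1 / π) * ∫ θ in (0 : ℝ)..π, exp (-(1 - cos θ) * t) * cos (n * θ) := by
  rw [scaledBesselI, besselI_eq_integral, mul_left_comm, ← intervalIntegral.integral_const_mul]
  congr 2
  funext θ
  rw [← mul_assoc, ← exp_add]
  ring_nf

theorem continuous_scaledBesselI (n : ℕ) : Continuous (scaledBesselI n) := by
  have : scaledBesselI n = fun t => (1 / π) * ∫ θ in (0 : ℝ)..π,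
      exp (-(1 - cos θ) * t) * cos (n * θ) := funext (scaledBesselI_eq_integral n)
  rw [this]
  refine continuous_const.mul (intervalIntegral.continuous_parametric_intervalIntegral_of_continuous'
    (by fun_prop) _ _)

theorem nat_mul_scaledBesselI (n : ℕ) (t : ℝ) :
    n * scaledBesselI n t =
      t * ((1 / π) * ∫ θ in (0 : ℝ)..π, exp (-(1 - cos θ) * t) * (sin θ * sin (n * θ))) := by
  have hd : ∀ θ ∈ Set.uIcc 0 π, HasDerivAt (fun θ => exp (-(1 - cos θ) * t) * sin (n * θ))
      (n * (exp (-(1 - cos θ) * t) * cos (n * θ)) -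
        t * (exp (-(1 - cos θ) * t) * (sin θ * sin (n * θ)))) θ := by
    intro θ _
    have h1 : HasDerivAt (fun θ => -(1 - cos θ) * t) (-(sin θ) * t) θ := by
      convert! (((hasDerivAt_cos θ).const_sub 1).neg.mul_const t) using 1
      ring
    have h2 : HasDerivAt (fun θ : ℝ => (n : ℝ) * θ) n θ := by
      simpa using (hasDerivAt_id θ).const_mul (n : ℝ)
    convert! h1.exp.mul h2.sin using 1
    ring
  have h := intervalIntegral.integral_eq_sub_of_hasDerivAt hd
    (Continuous.intervalIntegrable (by fun_prop) _ _)
  rw [intervalIntegral.integral_sub (Continuous.intervalIntegrable (by fun_prop) _ _)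
    (Continuous.intervalIntegrable (by fun_prop) _ _), intervalIntegral.integral_const_mul,
    intervalIntegral.integral_const_mul, sin_nat_mul_pi] at h
  simp only [mul_zero, sin_zero, sub_zero] at h
  rw [scaledBesselI_eq_integral]
  linear_combination (1 / π) * h

theorem scaledBesselI_sub (n : ℕ) (t : ℝ) :
    t * (scaledBesselI n t - scaledBesselI (n + 2) t) =
      2 * (n + 1 : ℕ) * scaledBesselI (n + 1) t := by
  rw [mul_assoc, nat_mul_scaledBesselI, scaledBesselI_eq_integral, scaledBesselI_eq_integral,
    ← mul_sub, ← intervalIntegral.integral_sub (Continuous.intervalIntegrable (by fun_prop) _ _)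
    (Continuous.intervalIntegrable (by fun_prop) _ _), mul_left_comm 2, mul_left_comm 2,
    ← intervalIntegral.integral_const_mul 2]
  congr 3
  funext θ
  have h1 : ((n : ℕ) : ℝ) * θ = ((n + 1 : ℕ) : ℝ) * θ - θ := by push_cast; ring
  have h2 : ((n + 2 : ℕ) : ℝ) * θ = ((n + 1 : ℕ) : ℝ) * θ + θ := by push_cast; ring
  rw [h1, h2, cos_sub, cos_add]
  ring

theorem abs_cos_sub_cos_le_sq_add_sq (a b : ℝ) : |cos a - cos b| ≤ (a ^ 2 + b ^ 2) / 2 := by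
  have h1 := one_sub_sq_div_two_le_cos (x := a)
  have h2 := one_sub_sq_div_two_le_cos (x := b)
  have h3 := cos_le_one a
  have h4 := cos_le_one b
  rw [abs_le]
  constructor <;> nlinarith [sq_nonneg a, sq_nonneg b]

theorem integrableOn_sq_mul_exp_neg_mul_sq {c : ℝ} (hc : 0 < c) :
    IntegrableOn (fun x : ℝ => x ^ 2 * exp (-c * x ^ 2)) (Set.Ioi 0) := by
  simpa using integrableOn_rpow_mul_exp_neg_mul_sq hc (s := 2) (by norm_num)

theorem integral_sq_mul_exp_neg_mul_sq {c : ℝ} (hc : 0 < c) :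
    ∫ x in Set.Ioi (0 : ℝ), x ^ 2 * exp (-c * x ^ 2) =
      c ^ (-3 / 2 : ℝ) * (1 / 2 * Gamma (3 / 2)) := by
  have h := integral_rpow_mul_exp_neg_mul_rpow (p := 2) (q := 2) two_pos (by norm_num) hc
  norm_num at h
  simp only [neg_mul]
  rw [h]
  norm_num
  ring

theorem integral_exp_mul_cos_half {t : ℝ} :
    ∫ θ in (0 : ℝ)..π, exp (-(1 - cos θ) * t) * cos (θ / 2) =
      2 * ∫ u in (0 : ℝ)..1, exp (-(2 * t) * u ^ 2) := by
  have hd : ∀ θ ∈ Set.uIcc 0 π, HasDerivAt (fun θ => sin (θ / 2)) (cos (θ / 2) * (1 / 2)) θ :=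
    fun θ _ => ((hasDerivAt_id θ).div_const 2).sin
  have h := intervalIntegral.integral_comp_mul_deriv hd (by fun_prop)
    (g := fun u => exp (-(2 * t) * u ^ 2)) (by fun_prop)
  simp only [zero_div, sin_zero, sin_pi_div_two] at h
  rw [← h, ← intervalIntegral.integral_const_mul]
  refine intervalIntegral.integral_congr fun θ _ => ?_
  have h2 : cos θ = 1 - 2 * sin (θ / 2) ^ 2 := by
    rw [show θ = 2 * (θ / 2) by ring, cos_two_mul, cos_sq']
    ring_nf
  simp only [Function.comp_apply, h2]
  ring_nf

theorem abs_integral_exp_neg_mul_sq_sub_le {c : ℝ} (hc : 0 < c) :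
    |(∫ u in (0 : ℝ)..1, exp (-c * u ^ 2)) - √(π / c) / 2| ≤
      c ^ (-3 / 2 : ℝ) * (1 / 2 * Gamma (3 / 2)) := by
  rw [← intervalIntegral.integral_Ioi_sub_Ioi (integrable_exp_neg_mul_sq hc).integrableOn
    zero_le_one, integral_gaussian_Ioi, sub_sub_cancel_left, abs_neg,
    abs_of_nonneg (integral_nonneg fun _ => (exp_pos _).le), ← integral_sq_mul_exp_neg_mul_sq hc]
  have hI := integrableOn_sq_mul_exp_neg_mul_sq hc
  have hsub : Set.Ioi (1 : ℝ) ⊆ Set.Ioi 0 := Set.Ioi_subset_Ioi zero_le_one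
  calc _ ≤ ∫ u in Set.Ioi (1 : ℝ), u ^ 2 * exp (-c * u ^ 2) := by
        refine setIntegral_mono_on (integrable_exp_neg_mul_sq hc).integrableOn (hI.mono_set hsub)
          measurableSet_Ioi fun u hu => ?_
        exact le_mul_of_one_le_left (exp_pos _).le (one_le_pow₀ (le_of_lt hu))
    _ ≤ _ := setIntegral_mono_set hI (Eventually.of_forall fun u => by positivity)
        hsub.eventuallyLE

/-- The leading large-time behaviour of the scaled Bessel function, with a uniform error bound. -/
theorem exists_abs_scaledBesselI_sub_le (n : ℕ) :
    ∃ C : ℝ, 0 ≤ C ∧ ∀ t : ℝ, 0 < t →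
      |scaledBesselI n t - (√(2 * π))⁻¹ * t ^ (-1 / 2 : ℝ)| ≤ C * t ^ (-3 / 2 : ℝ) := by
  have hG : 0 < Gamma (3 / 2) := Gamma_pos_of_pos (by norm_num)
  refine ⟨(1 / π) * ((n ^ 2 + 1) * ((2 / π ^ 2) ^ (-3 / 2 : ℝ) * (1 / 2 * Gamma (3 / 2))) +
    2 * (2 ^ (-3 / 2 : ℝ) * (1 / 2 * Gamma (3 / 2)))), by positivity, fun t ht => ?_⟩
  have hc : 0 < 2 / π ^ 2 * t := by positivity
  have hcos : |(∫ θ in (0 : ℝ)..π, exp (-(1 - cos θ) * t) * cos (n * θ)) -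
      ∫ θ in (0 : ℝ)..π, exp (-(1 - cos θ) * t) * cos (θ / 2)| ≤
      (n ^ 2 + 1) * ((2 / π ^ 2 * t) ^ (-3 / 2 : ℝ) * (1 / 2 * Gamma (3 / 2))) := by
    rw [← intervalIntegral.integral_sub (Continuous.intervalIntegrable (by fun_prop) _ _)
      (Continuous.intervalIntegrable (by fun_prop) _ _), ← Real.norm_eq_abs,
      ← integral_sq_mul_exp_neg_mul_sq hc]
    have hI := integrableOn_sq_mul_exp_neg_mul_sq hc
    calc _ ≤ ∫ θ in (0 : ℝ)..π, (n ^ 2 + 1) * (θ ^ 2 * exp (-(2 / π ^ 2 * t) * θ ^ 2)) := by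
          refine intervalIntegral.norm_integral_le_of_norm_le pi_pos.le
            (Eventually.of_forall fun θ hθ => ?_)
            (Continuous.intervalIntegrable (by fun_prop) _ _)
          have h1 := cos_le_one_sub_mul_cos_sq (x := θ) (abs_le.mpr ⟨by linarith [hθ.1, pi_pos], hθ.2⟩)
          have h2 := abs_cos_sub_cos_le_sq_add_sq (n * θ) (θ / 2)
          rw [← mul_sub, norm_mul, Real.norm_eq_abs, Real.norm_eq_abs, abs_exp, ← mul_assoc,
            mul_comm (exp _)]
          refine mul_le_mul (h2.trans ?_) (exp_le_exp.mpr ?_) (exp_pos _).le (by positivity)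
          · nlinarith [sq_nonneg θ, sq_nonneg (n * θ)]
          · nlinarith
      _ ≤ _ := by
          rw [intervalIntegral.integral_const_mul,
            intervalIntegral.integral_of_le pi_pos.le]
          exact mul_le_mul_of_nonneg_left (setIntegral_mono_set hI
            (Eventually.of_forall fun u => by positivity) Set.Ioc_subset_Ioi_self.eventuallyLE)
            (by positivity)
  rw [integral_exp_mul_cos_half] at hcos
  have hgauss := abs_integral_exp_neg_mul_sq_sub_le (c := 2 * t) (by positivity)
  rw [mul_rpow (by positivity) ht.le] at hcos hgauss
  have hlead : (√(2 * π))⁻¹ * t ^ (-1 / 2 : ℝ) = (1 / π) * (2 * (√(π / (2 * t)) / 2)) := by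
    have hs : t ^ (-1 / 2 : ℝ) = (√t)⁻¹ := by
      rw [sqrt_eq_rpow, ← rpow_neg ht.le]
      norm_num
    rw [hs, sqrt_div pi_pos.le, sqrt_mul zero_le_two, sqrt_mul zero_le_two]
    have hp : √π * √π = π := mul_self_sqrt pi_pos.le
    have h0 : √π ≠ 0 := (sqrt_pos.mpr pi_pos).ne'
    field_simp
    rw [sq, hp]
  rw [hlead, scaledBesselI_eq_integral, ← mul_sub, abs_mul, abs_of_pos (by positivity : 0 < 1 / π),
    mul_assoc]
  refine mul_le_mul_of_nonneg_left ?_ (by positivity)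
  set A := ∫ θ in (0 : ℝ)..π, exp (-(1 - cos θ) * t) * cos (n * θ)
  set B := ∫ u in (0 : ℝ)..1, exp (-(2 * t) * u ^ 2)
  rw [abs_le] at *
  constructor <;> nlinarith

theorem integral_cos_half_mul_sin {n : ℕ} (hn : 1 ≤ n) :
    ∫ θ in (0 : ℝ)..π, cos (θ / 2) * sin (n * θ) = n / ((n : ℝ) ^ 2 - 1 / 4) := by
  have hn' : (1 : ℝ) ≤ n := by exact_mod_cast hn
  have h0 : (n : ℝ) ^ 2 - 1 / 4 ≠ 0 := by nlinarith
  have hd : ∀ θ ∈ Set.uIcc 0 π, HasDerivAt (fun θ : ℝ => -(n * (cos (θ / 2) * cos (n * θ)) +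
      1 / 2 * (sin (θ / 2) * sin (n * θ))) / ((n : ℝ) ^ 2 - 1 / 4))
      (cos (θ / 2) * sin (n * θ)) θ := by
    intro θ _
    have h1 : HasDerivAt (fun θ : ℝ => θ / 2) (1 / 2) θ := (hasDerivAt_id θ).div_const 2
    have h2 : HasDerivAt (fun θ : ℝ => (n : ℝ) * θ) n θ := by
      simpa using (hasDerivAt_id θ).const_mul (n : ℝ)
    convert! ((((h1.cos.mul h2.cos).const_mul (n : ℝ)).add
      ((h1.sin.mul h2.sin).const_mul (1 / 2))).neg.div_const ((n : ℝ) ^ 2 - 1 / 4)) using 1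
    rw [eq_div_iff h0]
    ring
  rw [intervalIntegral.integral_eq_sub_of_hasDerivAt hd
    (Continuous.intervalIntegrable (by fun_prop) _ _)]
  simp [sin_nat_mul_pi]
  ring

theorem one_sub_cos_pos {θ : ℝ} (hθ : θ ∈ Set.Ioc 0 π) : 0 < 1 - cos θ := by
  have h := cos_lt_cos_of_nonneg_of_le_pi le_rfl hθ.2 hθ.1
  rw [cos_zero] at h
  linarith

theorem integrableOn_rpow_neg_half_mul_exp {c : ℝ} (hc : 0 < c) :
    IntegrableOn (fun t : ℝ => t ^ (-1 / 2 : ℝ) * exp (-c * t)) (Set.Ioi 0) := by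
  simpa using integrableOn_rpow_mul_exp_neg_mul_rpow (p := 1) (s := -1 / 2) (by norm_num)
    one_pos hc

theorem integral_rpow_neg_half_mul_exp {c : ℝ} (hc : 0 < c) :
    ∫ t in Set.Ioi (0 : ℝ), t ^ (-1 / 2 : ℝ) * exp (-c * t) = √π / √c := by
  have h := integral_rpow_mul_exp_neg_mul_Ioi (a := 1 / 2) (by norm_num) hc
  rw [Gamma_one_half_eq, ← sqrt_eq_rpow, sqrt_div zero_le_one, sqrt_one] at h
  norm_num at h
  norm_num [neg_mul]
  rw [h]
  ring

theorem sin_mul_div_sqrt_one_sub_cos {θ : ℝ} (hθ : θ ∈ Set.Ioc 0 π) :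
    √π / √(1 - cos θ) * sin θ = √(2 * π) * cos (θ / 2) := by
  have hs : 0 < sin (θ / 2) :=
    sin_pos_of_pos_of_lt_pi (by linarith [hθ.1]) (by linarith [hθ.2, pi_pos])
  have h2 : 1 - cos θ = 2 * sin (θ / 2) ^ 2 := by
    rw [show θ = 2 * (θ / 2) by ring, cos_two_mul, cos_sq']
    ring_nf
  have h3 : sin θ = 2 * sin (θ / 2) * cos (θ / 2) := by
    rw [← sin_two_mul]
    ring_nf
  rw [h2, h3, sqrt_mul zero_le_two, sqrt_mul zero_le_two, sqrt_sq hs.le]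
  have h4 : √2 * √2 = 2 := mul_self_sqrt zero_le_two
  field_simp
  linear_combination (-cos (θ / 2)) * h4

/-- The kernel whose `θ`-integral gives the Bessel moments. -/
noncomputable def momentKernel (n : ℕ) (t θ : ℝ) : ℝ :=
  t ^ (-1 / 2 : ℝ) * exp (-(1 - cos θ) * t) * (sin θ * sin (n * θ))

theorem integral_momentKernel (n : ℕ) {θ : ℝ} (hθ : θ ∈ Set.Ioc 0 π) :
    ∫ t in Set.Ioi (0 : ℝ), momentKernel n t θ = √(2 * π) * (cos (θ / 2) * sin (n * θ)) := by
  simp only [momentKernel]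
  rw [integral_mul_const, integral_rpow_neg_half_mul_exp (one_sub_cos_pos hθ), ← mul_assoc,
    sin_mul_div_sqrt_one_sub_cos hθ, mul_assoc]

theorem integral_norm_momentKernel (n : ℕ) {θ : ℝ} (hθ : θ ∈ Set.Ioc 0 π) :
    ∫ t in Set.Ioi (0 : ℝ), ‖momentKernel n t θ‖ =
      √(2 * π) * (cos (θ / 2) * |sin (n * θ)|) := by
  have hsin : 0 ≤ sin θ := sin_nonneg_of_nonneg_of_le_pi hθ.1.le hθ.2
  have h : Set.EqOn (fun t => ‖momentKernel n t θ‖) (fun t : ℝ => t ^ (-1 / 2 : ℝ) *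
      exp (-(1 - cos θ) * t) * (sin θ * |sin (n * θ)|)) (Set.Ioi 0) := by
    intro t ht
    have ht' : 0 < t := ht
    simp only [momentKernel]
    rw [norm_mul, norm_mul (sin θ), Real.norm_eq_abs (sin θ), abs_of_nonneg hsin,
      Real.norm_of_nonneg (by positivity), Real.norm_eq_abs]
  rw [setIntegral_congr_fun measurableSet_Ioi h, integral_mul_const,
    integral_rpow_neg_half_mul_exp (one_sub_cos_pos hθ), ← mul_assoc,
    sin_mul_div_sqrt_one_sub_cos hθ, mul_assoc]

theorem integrable_momentKernel (n : ℕ) :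
    Integrable (Function.uncurry (momentKernel n))
      ((volume.restrict (Set.Ioi (0 : ℝ))).prod (volume.restrict (Set.Ioc 0 π))) := by
  have hm : Measurable (Function.uncurry (momentKernel n)) := by
    unfold momentKernel Function.uncurry
    fun_prop
  rw [integrable_prod_iff' hm.aestronglyMeasurable]
  refine ⟨?_, ?_⟩
  · filter_upwards [ae_restrict_mem measurableSet_Ioc] with θ hθ
    simp only [Function.uncurry_apply_pair, momentKernel]
    exact (integrableOn_rpow_neg_half_mul_exp (one_sub_cos_pos hθ)).mul_const _
  · have hc : IntegrableOn (fun θ : ℝ => √(2 * π) * (cos (θ / 2) * |sin (n * θ)|))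
        (Set.Ioc 0 π) := by
      rw [← intervalIntegrable_iff_integrableOn_Ioc_of_le pi_pos.le]
      exact Continuous.intervalIntegrable (by fun_prop) _ _
    exact hc.congr_fun (fun θ hθ => (integral_norm_momentKernel n hθ).symm) measurableSet_Ioc

theorem scaledBesselI_mul_rpow_eq {n : ℕ} (hn : 1 ≤ n) {t : ℝ} (ht : 0 < t) :
    (n * π)⁻¹ * ∫ θ in Set.Ioc 0 π, momentKernel n t θ =
      scaledBesselI n t * t ^ (-3 / 2 : ℝ) := by
  have hn' : (n : ℝ) ≠ 0 := by positivity
  have h := nat_mul_scaledBesselI n t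
  have hr : t ^ (-1 / 2 : ℝ) = t * t ^ (-3 / 2 : ℝ) := by
    rw [← rpow_one_add' ht.le (by norm_num)]
    norm_num
  simp only [momentKernel, mul_assoc]
  rw [← intervalIntegral.integral_of_le pi_pos.le, intervalIntegral.integral_const_mul, hr]
  field_simp
  field_simp at h
  linear_combination -h

theorem integrableOn_scaledBesselI_mul_rpow {n : ℕ} (hn : 1 ≤ n) :
    IntegrableOn (fun t => scaledBesselI n t * t ^ (-3 / 2 : ℝ)) (Set.Ioi 0) :=
  IntegrableOn.congr_fun ((integrable_momentKernel n).integral_prod_left.const_mul (n * π)⁻¹)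
    (fun _ ht => scaledBesselI_mul_rpow_eq hn ht) measurableSet_Ioi

theorem integral_scaledBesselI_mul_rpow {n : ℕ} (hn : 1 ≤ n) :
    ∫ t in Set.Ioi (0 : ℝ), scaledBesselI n t * t ^ (-3 / 2 : ℝ) =
      √(2 * π) / π / ((n : ℝ) ^ 2 - 1 / 4) := by
  have hn' : (1 : ℝ) ≤ n := by exact_mod_cast hn
  have h0 : (n : ℝ) ^ 2 - 1 / 4 ≠ 0 := by nlinarith
  rw [← setIntegral_congr_fun measurableSet_Ioi
    (fun _ ht => scaledBesselI_mul_rpow_eq hn ht), integral_const_mul,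
    integral_integral_swap (integrable_momentKernel n),
    setIntegral_congr_fun measurableSet_Ioc (fun θ hθ => integral_momentKernel n hθ),
    ← intervalIntegral.integral_of_le pi_pos.le, intervalIntegral.integral_const_mul,
    integral_cos_half_mul_sin hn]
  field_simp

theorem scaledBesselI_succ_mul_rpow (n : ℕ) {t : ℝ} (ht : 0 < t) :
    (2 * (n + 1 : ℕ) : ℝ)⁻¹ * (scaledBesselI n t * t ^ (-3 / 2 : ℝ) -
      scaledBesselI (n + 2) t * t ^ (-3 / 2 : ℝ)) =
        scaledBesselI (n + 1) t * t ^ (-5 / 2 : ℝ) := by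
  have h := scaledBesselI_sub n t
  have hr : t ^ (-3 / 2 : ℝ) = t * t ^ (-5 / 2 : ℝ) := by
    rw [← rpow_one_add' ht.le (by norm_num)]
    norm_num
  have hn' : ((n + 1 : ℕ) : ℝ) ≠ 0 := by positivity
  rw [hr]
  field_simp
  linear_combination h

theorem integrableOn_scaledBesselI_succ_mul_rpow {n : ℕ} (hn : 1 ≤ n) :
    IntegrableOn (fun t => scaledBesselI (n + 1) t * t ^ (-5 / 2 : ℝ)) (Set.Ioi 0) :=
  IntegrableOn.congr_fun (((integrableOn_scaledBesselI_mul_rpow hn).sub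
    (integrableOn_scaledBesselI_mul_rpow (n := n + 2) (by omega))).const_mul _)
    (fun _ ht => scaledBesselI_succ_mul_rpow n ht) measurableSet_Ioi

theorem integral_scaledBesselI_succ_mul_rpow {n : ℕ} (hn : 1 ≤ n) :
    ∫ t in Set.Ioi (0 : ℝ), scaledBesselI (n + 1) t * t ^ (-5 / 2 : ℝ) =
      2 * (√(2 * π) / π) / (((n : ℝ) ^ 2 - 1 / 4) * (((n : ℝ) + 2) ^ 2 - 1 / 4)) := by
  have hn' : (1 : ℝ) ≤ n := by exact_mod_cast hn
  have h0 : (n : ℝ) ^ 2 - 1 / 4 ≠ 0 := by nlinarith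
  have h2 : ((n : ℝ) + 2) ^ 2 - 1 / 4 ≠ 0 := by nlinarith
  have h1 : (n : ℝ) + 1 ≠ 0 := by positivity
  rw [← setIntegral_congr_fun measurableSet_Ioi
    (fun _ ht => scaledBesselI_succ_mul_rpow n ht), integral_const_mul,
    integral_sub (integrableOn_scaledBesselI_mul_rpow hn)
      (integrableOn_scaledBesselI_mul_rpow (by omega)),
    integral_scaledBesselI_mul_rpow hn, integral_scaledBesselI_mul_rpow (by omega)]
  push_cast
  generalize √(2 * π) / π = r
  rw [div_sub_div _ _ h0 h2, inv_mul_eq_div, div_div, div_eq_div_iff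
    (mul_ne_zero (mul_ne_zero h0 h2) (by positivity)) (mul_ne_zero h0 h2)]
  ring

/-- The tail integral of `exp (-s) * besselI b s / s`. -/
noncomputable def besselTail (b : ℕ) (t : ℝ) : ℝ :=
  ∫ s in Set.Ioi t, scaledBesselI b s / s

theorem rpow_neg_three_halves_eq {t : ℝ} (ht : 0 < t) :
    t ^ (-3 / 2 : ℝ) = t ^ (-1 / 2 : ℝ) / t := by
  rw [← rpow_sub_one ht.ne']
  norm_num

theorem rpow_neg_five_halves_eq {t : ℝ} (ht : 0 < t) :
    t ^ (-5 / 2 : ℝ) = t ^ (-3 / 2 : ℝ) / t := by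
  rw [← rpow_sub_one ht.ne']
  norm_num

theorem abs_scaledBesselI_div_sub_le {b : ℕ} {C t : ℝ} (ht : 0 < t)
    (hC : |scaledBesselI b t - (√(2 * π))⁻¹ * t ^ (-1 / 2 : ℝ)| ≤ C * t ^ (-3 / 2 : ℝ)) :
    |scaledBesselI b t / t - (√(2 * π))⁻¹ * t ^ (-3 / 2 : ℝ)| ≤ C * t ^ (-5 / 2 : ℝ) := by
  rw [rpow_neg_five_halves_eq ht, rpow_neg_three_halves_eq ht, ← mul_div_assoc, ← sub_div,
    abs_div, abs_of_pos ht, ← mul_div_assoc, ← rpow_neg_three_halves_eq ht]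
  gcongr

theorem integrableOn_scaledBesselI_div (b : ℕ) {t : ℝ} (ht : 0 < t) :
    IntegrableOn (fun s => scaledBesselI b s / s) (Set.Ioi t) := by
  obtain ⟨C, hC0, hC⟩ := exists_abs_scaledBesselI_sub_le b
  have hq : IntegrableOn (fun s : ℝ => (√(2 * π))⁻¹ * s ^ (-3 / 2 : ℝ) + C * s ^ (-5 / 2 : ℝ))
      (Set.Ioi t) :=
    ((integrableOn_Ioi_rpow_of_lt (by norm_num) ht).const_mul _).add
      ((integrableOn_Ioi_rpow_of_lt (by norm_num) ht).const_mul _)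
  refine Integrable.mono' hq ?_ ?_
  · exact ((continuous_scaledBesselI b).measurable.div measurable_id).aestronglyMeasurable
  · filter_upwards [ae_restrict_mem measurableSet_Ioi] with s hs
    have hs0 : 0 < s := ht.trans hs
    rw [Real.norm_of_nonneg (div_nonneg (scaledBesselI_nonneg b hs0.le) hs0.le)]
    linarith [(abs_le.mp (abs_scaledBesselI_div_sub_le hs0 (hC s hs0))).2]

theorem antitoneOn_besselTail (b : ℕ) : AntitoneOn (besselTail b) (Set.Ioi 0) := by
  intro s hs t _ hst
  refine setIntegral_mono_set (integrableOn_scaledBesselI_div b hs) ?_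
    (Set.Ioi_subset_Ioi hst).eventuallyLE
  filter_upwards [ae_restrict_mem measurableSet_Ioi] with u hu
  have hu0 : 0 < u := lt_trans hs hu
  exact div_nonneg (scaledBesselI_nonneg b hu0.le) hu0.le

theorem exists_abs_besselTail_sub_le (b : ℕ) :
    ∃ C : ℝ, 0 ≤ C ∧ ∀ t : ℝ, 0 < t →
      |besselTail b t - 2 * (√(2 * π))⁻¹ * t ^ (-1 / 2 : ℝ)| ≤ C * t ^ (-3 / 2 : ℝ) := by
  obtain ⟨C, hC0, hC⟩ := exists_abs_scaledBesselI_sub_le b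
  refine ⟨C * (2 / 3), by positivity, fun t ht => ?_⟩
  have h3 : IntegrableOn (fun s : ℝ => s ^ (-3 / 2 : ℝ)) (Set.Ioi t) :=
    integrableOn_Ioi_rpow_of_lt (by norm_num) ht
  have h5 : IntegrableOn (fun s : ℝ => s ^ (-5 / 2 : ℝ)) (Set.Ioi t) :=
    integrableOn_Ioi_rpow_of_lt (by norm_num) ht
  have hlead : 2 * (√(2 * π))⁻¹ * t ^ (-1 / 2 : ℝ) =
      ∫ s in Set.Ioi t, (√(2 * π))⁻¹ * s ^ (-3 / 2 : ℝ) := by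
    rw [integral_const_mul, integral_Ioi_rpow_of_lt (by norm_num) ht]
    norm_num
    ring
  have herr : C * (2 / 3) * t ^ (-3 / 2 : ℝ) = ∫ s in Set.Ioi t, C * s ^ (-5 / 2 : ℝ) := by
    rw [integral_const_mul, integral_Ioi_rpow_of_lt (by norm_num) ht]
    norm_num
    ring
  rw [hlead, herr, besselTail, ← integral_sub (integrableOn_scaledBesselI_div b ht)
    (h3.const_mul _), ← Real.norm_eq_abs]
  refine norm_integral_le_of_norm_le (h5.const_mul _) ?_
  filter_upwards [ae_restrict_mem measurableSet_Ioi] with s hs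
  exact abs_scaledBesselI_div_sub_le (ht.trans hs) (hC s (ht.trans hs))

theorem Pfirst_eq (a b : ℕ) :
    Pfirst a b = a * b * ∫ t in Set.Ioi (0 : ℝ), scaledBesselI a t / t * besselTail b t :=
  rfl

theorem exists_abs_Pfirst_succ_sub_le (b : ℕ) :
    ∃ C : ℝ, 0 ≤ C ∧ ∀ n : ℕ, 1 ≤ n →
      |Pfirst (n + 1) b - 2 * b * (n + 1 : ℕ) / (π * (((n + 1 : ℕ) : ℝ) ^ 2 - 1 / 4))| ≤
        C * ((n + 1 : ℕ) / (((n : ℝ) ^ 2 - 1 / 4) * (((n : ℝ) + 2) ^ 2 - 1 / 4))) := by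
  obtain ⟨C, hC0, hC⟩ := exists_abs_besselTail_sub_le b
  refine ⟨b * C * (2 * (√(2 * π) / π)), by positivity, fun n hn => ?_⟩
  set q : ℝ := 2 * (√(2 * π))⁻¹ with hq
  set f : ℝ → ℝ := fun t => scaledBesselI (n + 1) t / t * (besselTail b t - q * t ^ (-1 / 2 : ℝ))
    with hf
  have h5 := integrableOn_scaledBesselI_succ_mul_rpow hn
  have h3 := integrableOn_scaledBesselI_mul_rpow (n := n + 1) (by omega)
  have hbound : ∀ᵐ t ∂(volume.restrict (Set.Ioi (0 : ℝ))),
      ‖f t‖ ≤ C * (scaledBesselI (n + 1) t * t ^ (-5 / 2 : ℝ)) := by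
    filter_upwards [ae_restrict_mem measurableSet_Ioi] with t ht
    have ht0 : 0 < t := ht
    have hpos := div_nonneg (scaledBesselI_nonneg (n + 1) ht0.le) ht0.le
    rw [hf, norm_mul, Real.norm_of_nonneg hpos, Real.norm_eq_abs]
    calc _ ≤ scaledBesselI (n + 1) t / t * (C * t ^ (-3 / 2 : ℝ)) :=
          mul_le_mul_of_nonneg_left (hC t ht0) hpos
      _ = _ := by
          rw [rpow_neg_five_halves_eq ht0]
          ring
  have hmeas : AEStronglyMeasurable f (volume.restrict (Set.Ioi (0 : ℝ))) := by
    have h1 : AEMeasurable (besselTail b) (volume.restrict (Set.Ioi (0 : ℝ))) :=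
      aemeasurable_restrict_of_antitoneOn measurableSet_Ioi (antitoneOn_besselTail b)
    have h2 : Measurable fun t => scaledBesselI (n + 1) t / t :=
      (continuous_scaledBesselI (n + 1)).measurable.div measurable_id
    have h3 : Measurable fun t : ℝ => q * t ^ (-1 / 2 : ℝ) := by fun_prop
    exact (h2.aemeasurable.mul (h1.sub h3.aemeasurable)).aestronglyMeasurable
  have hfi : IntegrableOn f (Set.Ioi 0) := Integrable.mono' (h5.const_mul C) hmeas hbound
  have hsplit : ∫ t in Set.Ioi (0 : ℝ), scaledBesselI (n + 1) t / t * besselTail b t =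
      (∫ t in Set.Ioi (0 : ℝ), f t) +
        q * ∫ t in Set.Ioi (0 : ℝ), scaledBesselI (n + 1) t * t ^ (-3 / 2 : ℝ) := by
    rw [← integral_const_mul, ← integral_add hfi (h3.const_mul q)]
    refine setIntegral_congr_fun measurableSet_Ioi fun t ht => ?_
    simp only [hf]
    rw [rpow_neg_three_halves_eq ht]
    ring
  have hnorm := norm_integral_le_of_norm_le (h5.const_mul C) hbound
  rw [integral_const_mul, integral_scaledBesselI_succ_mul_rpow hn, Real.norm_eq_abs] at hnorm
  have hqq : q * (√(2 * π) / π) = 2 / π := by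
    have : √(2 * π) ≠ 0 := by positivity
    rw [hq]
    field_simp
  have hmain : Pfirst (n + 1) b - 2 * b * (n + 1 : ℕ) / (π * (((n + 1 : ℕ) : ℝ) ^ 2 - 1 / 4)) =
      (n + 1 : ℕ) * b * ∫ t in Set.Ioi (0 : ℝ), f t := by
    rw [Pfirst_eq, hsplit, integral_scaledBesselI_mul_rpow (by omega), ← mul_div_assoc, hqq,
      div_div]
    ring
  rw [hmain, abs_mul, abs_of_nonneg (by positivity)]
  calc _ ≤ _ := mul_le_mul_of_nonneg_left hnorm (by positivity)
    _ = _ := by ring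

theorem exists_abs_Pfirst_sub_le (b : ℕ) :
    ∃ C : ℝ, ∀ a : ℕ, 2 ≤ a → |Pfirst a b - 2 * b / (π * a)| ≤ C * (a : ℝ) ^ (-3 : ℤ) := by
  obtain ⟨C, hC0, hC⟩ := exists_abs_Pfirst_succ_sub_le b
  refine ⟨C * 16 + b / π, fun a ha => ?_⟩
  obtain ⟨n, rfl⟩ : ∃ n, a = n + 1 := ⟨a - 1, by omega⟩
  have h := hC n (by omega)
  have hn : (1 : ℝ) ≤ n := by exact_mod_cast (by omega : 1 ≤ n)
  push_cast at h ⊢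
  set x : ℝ := (n : ℝ) + 1 with hx
  have hx2 : 2 ≤ x := by linarith
  have hx0 : 0 < x := by linarith
  have hp : x ^ (-3 : ℤ) = 1 / x ^ 3 := by
    rw [zpow_neg, one_div]
    norm_cast
  have hd1 : x ^ 2 / 8 ≤ (n : ℝ) ^ 2 - 1 / 4 := by
    rw [show (n : ℝ) = x - 1 by linarith]
    nlinarith
  have hd2 : x ^ 2 / 2 ≤ ((n : ℝ) + 2) ^ 2 - 1 / 4 := by
    rw [show (n : ℝ) = x - 1 by linarith]
    nlinarith
  have hd3 : x ^ 2 / 2 ≤ x ^ 2 - 1 / 4 := by nlinarith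
  have hd0 : 0 ≤ (n : ℝ) ^ 2 - 1 / 4 := by nlinarith
  have h1 : x / (((n : ℝ) ^ 2 - 1 / 4) * (((n : ℝ) + 2) ^ 2 - 1 / 4)) ≤ 16 * (1 / x ^ 3) := by
    calc _ ≤ x / (x ^ 2 / 8 * (x ^ 2 / 2)) := by gcongr
      _ = _ := by
        field_simp
        norm_num
  have h2 : |2 * b * x / (π * (x ^ 2 - 1 / 4)) - 2 * b / (π * x)| ≤ b / π * (1 / x ^ 3) := by
    have hpos : 0 < x ^ 2 - 1 / 4 := by nlinarith
    have hne := hpos.ne'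
    have he : 2 * b * x / (π * (x ^ 2 - 1 / 4)) - 2 * b / (π * x) =
        b / π * (1 / (2 * x * (x ^ 2 - 1 / 4))) := by
      rw [div_sub_div _ _ (mul_ne_zero pi_ne_zero hne) (by positivity), div_mul_div_comm,
        div_eq_div_iff (by positivity) (by positivity)]
      ring
    rw [he, abs_of_nonneg (by positivity)]
    refine mul_le_mul_of_nonneg_left (one_div_le_one_div_of_le (by positivity) ?_) (by positivity)
    nlinarith
  rw [hp]
  calc _ ≤ |Pfirst (n + 1) b - 2 * b * x / (π * (x ^ 2 - 1 / 4))| +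
        |2 * b * x / (π * (x ^ 2 - 1 / 4)) - 2 * b / (π * x)| := abs_sub_le _ _ _
    _ ≤ C * (16 * (1 / x ^ 3)) + b / π * (1 / x ^ 3) :=
        add_le_add (h.trans (mul_le_mul_of_nonneg_left h1 hC0)) h2
    _ = _ := by ring

theorem Pfirst_asymptotic_first_order (b : ℕ) (hb : 1 ≤ b) :
    ((fun a : ℕ => Pfirst a b - 2 * (b : ℝ) / (Real.pi * a))
        =O[atTop] fun a : ℕ => ((a : ℝ)) ^ (-3 : ℤ)) ∧
    Tendsto (fun a : ℕ => (a : ℝ) * Pfirst a b) atTop (nhds (2 * (b : ℝ) / Real.pi)) := by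
  have hO : (fun a : ℕ => Pfirst a b - 2 * (b : ℝ) / (Real.pi * a))
      =O[atTop] fun a : ℕ => ((a : ℝ)) ^ (-3 : ℤ) := by
    obtain ⟨C, hC⟩ := exists_abs_Pfirst_sub_le b
    refine IsBigO.of_bound C ?_
    filter_upwards [eventually_ge_atTop 2] with a ha
    rw [Real.norm_eq_abs, Real.norm_of_nonneg (by positivity)]
    exact hC a ha
  refine ⟨hO, ?_⟩
  have h1 : (fun a : ℕ => (a : ℝ) * (Pfirst a b - 2 * (b : ℝ) / (Real.pi * a)))
      =O[atTop] fun a : ℕ => (a : ℝ) * (a : ℝ) ^ (-3 : ℤ) := (isBigO_refl _ _).mul hO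
  have h2 : Tendsto (fun a : ℕ => (a : ℝ) * (a : ℝ) ^ (-3 : ℤ)) atTop (nhds 0) := by
    have h3 : Tendsto (fun a : ℕ => (a : ℝ) ^ (-2 : ℤ)) atTop (nhds 0) :=
      (tendsto_zpow_atTop_zero (by norm_num)).comp tendsto_natCast_atTop_atTop
    refine h3.congr' ?_
    filter_upwards [eventually_ge_atTop 1] with a ha
    have ha' : (a : ℝ) ≠ 0 := by positivity
    rw [← zpow_one_add₀ ha']
    norm_num
  have h4 := (h1.trans_tendsto h2).add_const (2 * (b : ℝ) / π)
  rw [zero_add] at h4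
  refine h4.congr' ?_
  filter_upwards [eventually_ge_atTop 1] with a ha
  have ha' : (a : ℝ) ≠ 0 := by positivity
  field_simp
  ring
end
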